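/- Let F : U → ℂ² be an injective holomorphic map on a neighborhood U of 0 in ℂ², with F(0) = 0, and let 0 < r with the closed ball B̄_r(0) ⊆ U. For k ≥ 1 let P_k = {p ∈ B̄_r(0) : F(p), ..., F^{k−1}(p) ∈ B̄_r(0) and Fᵏ(p) = p}. Then P_k is a compact semianalytic subset of U: locally it is the intersection of the real-analytic equations Re(x∘Fᵏ − x) = Im(x∘Fᵏ − x) = Re(y∘Fᵏ − y) = Im(y∘Fᵏ − y) = 0 with the real-analytic inequalities r² − |x∘Fˡ|² − |y∘Fˡ|² ≥ 0 for 0 ≤ l ≤ k−1. In particular P_k has finitely many connected components. -/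

import Mathlib

open Topology Filter

/-- A subset `X` of (an ambient set `M` in) a real normed space is semianalytic in `M` if
each point of `M` has a neighborhood `V` on which `X` is a finite union of finite
intersections of zero sets `{f = 0}` and open sets `{f > 0}` of real-analytic functions. -/
def Semianalytic {E : Type*} [NormedAddCommGroup E] [NormedSpace ℝ E]
    (M X : Set E) : Prop :=
  ∀ p ∈ M, ∃ V ∈ 𝓝 p, ∃ (N : ℕ) (I : Fin N → ℕ)
    (f : (i : Fin N) → Fin (I i) → E → ℝ) (s : (i : Fin N) → Fin (I i) → Bool),
    (∀ i j, ∀ x ∈ V, AnalyticAt ℝ (f i j) x) ∧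
    X ∩ V = (⋃ i, ⋂ j, {x | if s i j then f i j x = 0 else 0 < f i j x}) ∩ V

open scoped ENNReal NNReal

namespace ConvSeries

variable {n : ℕ}

/-- A multiplicative injective size of multi-exponents: `α ↦ ∏ pᵢ ^ αᵢ` with `pᵢ` the
`i`-th prime. -/
noncomputable def size (α : Fin n →₀ ℕ) : ℕ := α.prod fun i k => Nat.nth Nat.Prime i ^ k

lemma prime_nth (i : ℕ) : (Nat.nth Nat.Prime i).Prime :=
  Nat.nth_mem_of_infinite Nat.infinite_setOfPred_prime i

lemma size_add (α β : Fin n →₀ ℕ) : size (α + β) = size α * size β :=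
  Finsupp.prod_add_index' (by simp) (fun _ _ _ => pow_add _ _ _)

lemma size_pos (α : Fin n →₀ ℕ) : 0 < size α :=
  Finset.prod_pos fun i _ => pow_pos (prime_nth i).pos _

lemma size_injective : Function.Injective (size (n := n)) := by
  intro α β h
  let p : Fin n ↪ ℕ := ⟨fun i => Nat.nth Nat.Prime i, fun i j hij =>
    Fin.ext (Nat.nth_injective Nat.infinite_setOfPred_prime hij)⟩
  have key : ∀ γ : Fin n →₀ ℕ, (size γ).factorization = γ.embDomain p := by
    intro γ
    rw [← Nat.prod_pow_factorization_eq_self (f := γ.embDomain p)]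
    · congr 1
      rw [Finsupp.prod_embDomain]
      rfl
    · intro q hq
      rw [Finsupp.support_embDomain, Finset.mem_map] at hq
      obtain ⟨i, -, rfl⟩ := hq
      exact prime_nth i
  exact Finsupp.embDomain_injective p (by rw [← key, ← key, h])

/-- The weight of a multi-exponent. -/
noncomputable def wt (τ : ℕ) (α : Fin n →₀ ℕ) : ℝ≥0∞ := ((size α : ℝ≥0∞)⁻¹) ^ τ

lemma wt_add (τ : ℕ) (α β : Fin n →₀ ℕ) : wt τ (α + β) = wt τ α * wt τ β := by
  simp only [wt, size_add, Nat.cast_mul]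
  rw [ENNReal.mul_inv (by simp) (by simp), mul_pow]

lemma wt_ne_top (τ : ℕ) (α : Fin n →₀ ℕ) : wt τ α ≠ ⊤ :=
  ENNReal.pow_ne_top (ENNReal.inv_ne_top.2 (by exact_mod_cast (size_pos α).ne'))

lemma wt_ne_zero (τ : ℕ) (α : Fin n →₀ ℕ) : wt τ α ≠ 0 :=
  pow_ne_zero _ (ENNReal.inv_ne_zero.2 (by simp))

lemma wt_add_exp (τ m : ℕ) (α : Fin n →₀ ℕ) : wt (τ + m) α = wt τ α * wt m α := pow_add _ _ _

lemma wt_le_one (τ : ℕ) (α : Fin n →₀ ℕ) : wt τ α ≤ 1 := by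
  refine pow_le_one₀ (zero_le) (ENNReal.inv_le_one.2 ?_)
  exact_mod_cast size_pos α

lemma wt_antitone (α : Fin n →₀ ℕ) : Antitone fun τ => wt τ α := by
  intro τ τ' h
  obtain ⟨m, rfl⟩ := Nat.exists_eq_add_of_le h
  simp only [wt_add_exp]
  exact mul_le_of_le_one_right' (wt_le_one _ _)

/-- The weighted `ℓ¹` norm of a formal power series. -/
noncomputable def nrm (τ : ℕ) (a : MvPowerSeries (Fin n) ℝ) : ℝ≥0∞ :=
  ∑' α, ‖MvPowerSeries.coeff α a‖ₑ * wt τ α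

lemma nrm_add_le (τ : ℕ) (a b : MvPowerSeries (Fin n) ℝ) : nrm τ (a + b) ≤ nrm τ a + nrm τ b := by
  unfold nrm
  rw [← ENNReal.tsum_add]
  refine ENNReal.tsum_le_tsum fun α => ?_
  rw [← add_mul, map_add]
  gcongr
  exact enorm_add_le _ _

lemma nrm_zero (τ : ℕ) : nrm τ (0 : MvPowerSeries (Fin n) ℝ) = 0 := by simp [nrm]

lemma nrm_neg (τ : ℕ) (a : MvPowerSeries (Fin n) ℝ) : nrm τ (-a) = nrm τ a := by simp [nrm]

lemma nrm_sum_le {ι : Type*} (τ : ℕ) (s : Finset ι) (a : ι → MvPowerSeries (Fin n) ℝ) :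
    nrm τ (∑ i ∈ s, a i) ≤ ∑ i ∈ s, nrm τ (a i) :=
  Finset.le_sum_of_subadditive _ (nrm_zero τ).le (nrm_add_le τ) _ _

lemma nrm_mul_le (τ : ℕ) (a b : MvPowerSeries (Fin n) ℝ) : nrm τ (a * b) ≤ nrm τ a * nrm τ b := by
  classical
  unfold nrm
  simp_rw [← ENNReal.tsum_mul_right, ← ENNReal.tsum_mul_left]
  rw [← ENNReal.tsum_prod (f := fun α β => ‖MvPowerSeries.coeff α a‖ₑ * wt τ α *
    (‖MvPowerSeries.coeff β b‖ₑ * wt τ β)),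
    ← Finset.HasAntidiagonal.sigmaAntidiagonalEquivProd.tsum_eq, ENNReal.tsum_sigma']
  refine ENNReal.tsum_le_tsum fun α => ?_
  rw [tsum_fintype, MvPowerSeries.coeff_mul]
  simp only [Finset.HasAntidiagonal.sigmaAntidiagonalEquivProd_apply]
  rw [← Finset.sum_coe_sort]
  calc _ ≤ (∑ i : Finset.HasAntidiagonal.antidiagonal α, ‖MvPowerSeries.coeff i.1.1 a *
        MvPowerSeries.coeff i.1.2 b‖ₑ) * wt τ α := by
        gcongr
        exact enorm_sum_le _ _
    _ = _ := by
        rw [Finset.sum_mul]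
        refine Finset.sum_congr rfl fun i _ => ?_
        have h : wt τ α = wt τ i.1.1 * wt τ i.1.2 := by
          rw [← wt_add, Finset.HasAntidiagonal.mem_antidiagonal.1 i.2]
        rw [h, enorm_mul]
        ring

lemma nrm_antitone (a : MvPowerSeries (Fin n) ℝ) : Antitone fun τ => nrm τ a := fun _ _ h =>
  ENNReal.tsum_le_tsum fun α => mul_le_mul_right (wt_antitone α h) _

lemma nrm_monomial (τ : ℕ) (e : Fin n →₀ ℕ) (c : ℝ) :
    nrm τ (MvPowerSeries.monomial e c) = ‖c‖ₑ * wt τ e := by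
  classical
  unfold nrm
  rw [tsum_eq_single e]
  · simp
  · intro β hβ
    simp [MvPowerSeries.coeff_monomial, hβ]

/-- The ring of convergent power series. -/
noncomputable def convSeries (n : ℕ) : Subring (MvPowerSeries (Fin n) ℝ) where
  carrier := {a | ∃ τ, nrm τ a ≠ ⊤}
  zero_mem' := ⟨0, by simp [nrm_zero]⟩
  one_mem' := ⟨0, by
    rw [← MvPowerSeries.monomial_zero_one, nrm_monomial]
    exact ENNReal.mul_ne_top (by simp) (wt_ne_top _ _)⟩
  add_mem' := by
    rintro a b ⟨τ, ha⟩ ⟨τ', hb⟩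
    refine ⟨max τ τ', ne_top_of_le_ne_top (ENNReal.add_ne_top.2 ⟨?_, ?_⟩) (nrm_add_le _ _ _)⟩
    · exact ne_top_of_le_ne_top ha (nrm_antitone a (le_max_left _ _))
    · exact ne_top_of_le_ne_top hb (nrm_antitone b (le_max_right _ _))
  mul_mem' := by
    rintro a b ⟨τ, ha⟩ ⟨τ', hb⟩
    refine ⟨max τ τ', ne_top_of_le_ne_top (ENNReal.mul_ne_top ?_ ?_) (nrm_mul_le _ _ _)⟩
    · exact ne_top_of_le_ne_top ha (nrm_antitone a (le_max_left _ _))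
    · exact ne_top_of_le_ne_top hb (nrm_antitone b (le_max_right _ _))
  neg_mem' := by
    rintro a ⟨τ, ha⟩
    exact ⟨τ, by rwa [nrm_neg]⟩

/-- A series all of whose exponents are larger than `e` becomes small compared with `xᵉ`. -/
lemma eventually_nrm_le (h : MvPowerSeries (Fin n) ℝ) (hc : h ∈ convSeries n) (e : Fin n →₀ ℕ)
    (hh : ∀ α, size α ≤ size e → MvPowerSeries.coeff α h = 0) {ε : ℝ≥0∞} (hε : 0 < ε) :
    ∀ᶠ τ in atTop, nrm τ h ≤ ε * wt τ e := by
  obtain ⟨τ₀, hτ₀⟩ := hc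
  set E : ℝ≥0∞ := ((size e : ℕ) : ℝ≥0∞) with hE
  have hE0 : E ≠ 0 := by rw [hE]; exact_mod_cast (size_pos e).ne'
  have hEt : E ≠ ⊤ := by simp [hE]
  have hlt : (E + 1)⁻¹ * E < 1 := by
    rw [mul_comm, ← div_eq_mul_inv]
    refine ENNReal.div_lt_of_lt_mul ?_
    rw [one_mul]
    exact ENNReal.lt_add_right hEt one_ne_zero
  have ht : Tendsto (fun m : ℕ => ((E + 1)⁻¹ * E) ^ m * (nrm τ₀ h * E ^ τ₀)) atTop (𝓝 0) := by
    have := ENNReal.Tendsto.mul_const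
      (ENNReal.tendsto_pow_atTop_nhds_zero_of_lt_one hlt) (b := nrm τ₀ h * E ^ τ₀)
      (Or.inr (ENNReal.mul_ne_top hτ₀ (ENNReal.pow_ne_top hEt)))
    simpa using this
  have hev := (ht.eventually (gt_mem_nhds hε))
  obtain ⟨M, hM⟩ := eventually_atTop.1 hev
  refine eventually_atTop.2 ⟨τ₀ + M, fun τ hτ => ?_⟩
  obtain ⟨k, rfl⟩ := Nat.exists_eq_add_of_le hτ
  rw [add_assoc]
  have h1 : nrm (τ₀ + (M + k)) h ≤ nrm τ₀ h * ((E + 1)⁻¹) ^ (M + k) := by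
    unfold nrm
    rw [← ENNReal.tsum_mul_right]
    refine ENNReal.tsum_le_tsum fun α => ?_
    by_cases hα : size α ≤ size e
    · simp [hh α hα]
    rw [wt_add_exp, ← mul_assoc]
    gcongr
    rw [wt]
    gcongr
    rw [hE]
    exact_mod_cast not_le.1 hα
  refine h1.trans ?_
  have h2 := (hM (M + k) (by omega)).le
  have h3 : wt (τ₀ + (M + k)) e * E ^ (τ₀ + (M + k)) = 1 := by
    rw [wt, ← mul_pow, ENNReal.inv_mul_cancel hE0 hEt, one_pow]
  calc nrm τ₀ h * ((E + 1)⁻¹) ^ (M + k)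
      = nrm τ₀ h * ((E + 1)⁻¹) ^ (M + k) * (wt (τ₀ + (M + k)) e * E ^ (τ₀ + (M + k))) := by
        rw [h3, mul_one]
    _ = (((E + 1)⁻¹ * E) ^ (M + k) * (nrm τ₀ h * E ^ τ₀)) * wt (τ₀ + (M + k)) e := by
        rw [mul_pow, pow_add E]; ring
    _ ≤ _ := by gcongr

/-- The quotient by `xᵉ` of the part of a series supported on exponents `α = β + e` with
`s α`. -/
noncomputable def shiftPart (s : (Fin n →₀ ℕ) → Prop) (e : Fin n →₀ ℕ) :
    MvPowerSeries (Fin n) ℝ →ₗ[ℝ] MvPowerSeries (Fin n) ℝ := by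
  classical
  exact
  { toFun := fun f β => if s (β + e) then MvPowerSeries.coeff (β + e) f else 0
    map_add' := fun f g => by
      funext β
      change (if s (β + e) then f (β + e) + g (β + e) else 0) =
        (if s (β + e) then f (β + e) else 0) + (if s (β + e) then g (β + e) else 0)
      split_ifs <;> simp
    map_smul' := fun c f => by
      funext β
      change (if s (β + e) then c * f (β + e) else 0) = c * (if s (β + e) then f (β + e) else 0)
      split_ifs <;> simp }

open Classical in
lemma coeff_shiftPart (s : (Fin n →₀ ℕ) → Prop) (e β : Fin n →₀ ℕ) (f : MvPowerSeries (Fin n) ℝ) :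
    MvPowerSeries.coeff β (shiftPart s e f) =
      if s (β + e) then MvPowerSeries.coeff (β + e) f else 0 := rfl

open Classical in
lemma coeff_shiftPart_mul_monomial (s : (Fin n →₀ ℕ) → Prop) (e : Fin n →₀ ℕ)
    (hs : ∀ α, s α → e ≤ α) (α : Fin n →₀ ℕ) (f : MvPowerSeries (Fin n) ℝ) :
    MvPowerSeries.coeff α (shiftPart s e f * MvPowerSeries.monomial e 1) =
      if s α then MvPowerSeries.coeff α f else 0 := by
  rw [MvPowerSeries.coeff_mul_monomial]
  by_cases h : e ≤ α
  · rw [if_pos h, coeff_shiftPart, tsub_add_cancel_of_le h, mul_one]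
  · rw [if_neg h, if_neg fun h' => h (hs α h')]

lemma nrm_shiftPart_mul_le (τ : ℕ) (s : (Fin n →₀ ℕ) → Prop) (e : Fin n →₀ ℕ)
    (f : MvPowerSeries (Fin n) ℝ) : nrm τ (shiftPart s e f) * wt τ e ≤ nrm τ f := by
  unfold nrm
  rw [← ENNReal.tsum_mul_right]
  calc _ ≤ ∑' β, ‖MvPowerSeries.coeff (β + e) f‖ₑ * wt τ (β + e) := by
        refine ENNReal.tsum_le_tsum fun β => ?_
        rw [coeff_shiftPart, wt_add, mul_assoc]
        gcongr
        split_ifs <;> simp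
    _ ≤ _ := ENNReal.tsum_comp_le_tsum_of_injective (add_left_injective e) _

lemma coeff_mul_eq_zero_of_size_lt {M : ℕ} {q h : MvPowerSeries (Fin n) ℝ} {e : Fin n →₀ ℕ}
    (hq : ∀ β, size (β + e) < M → MvPowerSeries.coeff β q = 0)
    (hh : ∀ γ, size γ ≤ size e → MvPowerSeries.coeff γ h = 0) (α : Fin n →₀ ℕ)
    (hα : size α < M + 1) : MvPowerSeries.coeff α (q * h) = 0 := by
  classical
  rw [MvPowerSeries.coeff_mul]
  refine Finset.sum_eq_zero fun p hp => ?_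
  rw [← Finset.HasAntidiagonal.mem_antidiagonal.1 hp, size_add] at hα
  by_cases h2 : size p.2 ≤ size e
  · rw [hh _ h2, mul_zero]
  · rw [hq, zero_mul]
    rw [size_add]
    have := Nat.mul_lt_mul_of_pos_left (not_le.1 h2) (size_pos p.1)
    omega

/-- Division of formal power series by finitely many series with prescribed leading exponents,
preserving convergence. -/
theorem division {ι : Type*} [Fintype ι] (g : ι → MvPowerSeries (Fin n) ℝ)
    (e : ι → Fin n →₀ ℕ) (hg : ∀ i, g i ∈ convSeries n)
    (hlead : ∀ i, MvPowerSeries.coeff (e i) (g i) = 1)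
    (hlow : ∀ i α, size α ≤ size (e i) → α ≠ e i → MvPowerSeries.coeff α (g i) = 0)
    (f : MvPowerSeries (Fin n) ℝ) (hf : f ∈ convSeries n) :
    ∃ (q : ι → MvPowerSeries (Fin n) ℝ) (r : MvPowerSeries (Fin n) ℝ),
      (∀ i, q i ∈ convSeries n) ∧ f = ∑ i, q i * g i + r ∧
      ∀ α i, e i ≤ α → MvPowerSeries.coeff α r = 0 := by
  classical
  have hsel : ∀ α : Fin n →₀ ℕ, ∃ o : Option ι, (∀ i, o = some i → e i ≤ α) ∧
      (o = none → ∀ i, ¬ e i ≤ α) := by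
    intro α
    by_cases h : ∃ i, e i ≤ α
    · obtain ⟨i, hi⟩ := h
      exact ⟨some i, by simpa using hi, by simp⟩
    · push Not at h
      exact ⟨none, by simp, fun _ => h⟩
  choose sel hsel1 hsel2 using hsel
  set Q : ι → MvPowerSeries (Fin n) ℝ →ₗ[ℝ] MvPowerSeries (Fin n) ℝ :=
    fun i => shiftPart (fun α => sel α = some i) (e i) with hQ
  set h : ι → MvPowerSeries (Fin n) ℝ := fun i => MvPowerSeries.monomial (e i) 1 - g i with hh
  have hmon : ∀ i, MvPowerSeries.monomial (e i) (1 : ℝ) ∈ convSeries n := fun i =>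
    ⟨0, by rw [nrm_monomial]; exact ENNReal.mul_ne_top (by simp) (wt_ne_top _ _)⟩
  have hhlow : ∀ i γ, size γ ≤ size (e i) → MvPowerSeries.coeff γ (h i) = 0 := by
    intro i γ hγ
    by_cases hγe : γ = e i
    · subst hγe; simp [hh, hlead]
    · simp [hh, hlow i γ hγ hγe, MvPowerSeries.coeff_monomial, hγe]
  set K : MvPowerSeries (Fin n) ℝ →ₗ[ℝ] MvPowerSeries (Fin n) ℝ :=
    ∑ i, (LinearMap.mulRight ℝ (h i)).comp (Q i) with hK
  have hKapp : ∀ a, K a = ∑ i, Q i a * h i := fun a => by simp [hK]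
  have hKlow : ∀ M a, (∀ α, size α < M → MvPowerSeries.coeff α a = 0) →
      ∀ α, size α < M + 1 → MvPowerSeries.coeff α (K a) = 0 := by
    intro M a ha α hα
    rw [hKapp, map_sum]
    refine Finset.sum_eq_zero fun i _ => ?_
    refine coeff_mul_eq_zero_of_size_lt (M := M) (e := e i) (fun β hβ => ?_) (hhlow i) α hα
    rw [hQ, coeff_shiftPart]
    split_ifs
    · exact ha _ hβ
    · rfl
  have hKpow : ∀ m a α, size α < m → MvPowerSeries.coeff α ((K ^ m) a) = 0 := by
    intro m
    induction m with
    | zero => intro a α hα; omega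
    | succ m ih =>
      intro a α hα
      rw [pow_succ', Module.End.mul_apply]
      exact hKlow m _ (fun β hβ => ih a β hβ) α hα
  set V : ℕ → MvPowerSeries (Fin n) ℝ := fun M => ∑ m ∈ Finset.range M, (K ^ m) f with hV
  set u : MvPowerSeries (Fin n) ℝ := fun α => MvPowerSeries.coeff α (V (size α + 1)) with hu
  have huV : ∀ M α, size α < M → MvPowerSeries.coeff α u = MvPowerSeries.coeff α (V M) := by
    intro M α hα
    have : MvPowerSeries.coeff α u = MvPowerSeries.coeff α (V (size α + 1)) := by
      rw [MvPowerSeries.coeff_apply]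
    rw [this, hV]
    simp only [map_sum]
    refine Finset.sum_subset (Finset.range_subset_range.2 hα) fun m _ hm => ?_
    exact hKpow m f α (by simp at hm; omega)
  have hfix : u - K u = f := by
    ext α
    set M := size α + 1 with hM
    have h1 : MvPowerSeries.coeff α (K (u - V M)) = 0 :=
      hKlow M _ (fun β hβ => by rw [map_sub, huV M β hβ, sub_self]) α (by omega)
    have h2 : V M - K (V M) = f - (K ^ M) f := by
      simp only [hV, map_sum]
      have : ∀ m, K ((K ^ m) f) = (K ^ (m + 1)) f := fun m => by
        rw [pow_succ', Module.End.mul_apply]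
      simp_rw [this]
      rw [← Finset.sum_sub_distrib, Finset.sum_range_sub']
      simp
    have h3 := congrArg (MvPowerSeries.coeff α) h2
    rw [map_sub, map_sub, hKpow M f α (by omega), sub_zero] at h3
    rw [map_sub, map_sub, sub_eq_zero] at h1
    rw [map_sub, h1, huV M α (by omega), h3]
  have huc : u ∈ convSeries n := by
    obtain ⟨τ₀, hτ₀⟩ := hf
    have hε : (0 : ℝ≥0∞) < 2⁻¹ / (Fintype.card ι + 1) :=
      ENNReal.div_pos (by simp) (by finiteness)
    have hev : ∀ᶠ τ in atTop, ∀ i, nrm τ (h i) ≤ 2⁻¹ / (Fintype.card ι + 1) * wt τ (e i) :=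
      eventually_all.2 fun i => eventually_nrm_le (h i)
        (sub_mem (hmon i) (hg i)) (e i) (hhlow i) hε
    obtain ⟨τ, hτ, hττ₀⟩ := (hev.and (eventually_ge_atTop τ₀)).exists
    have hfτ : nrm τ f ≠ ⊤ := ne_top_of_le_ne_top hτ₀ (nrm_antitone f hττ₀)
    have hKn : ∀ a, nrm τ (K a) ≤ 2⁻¹ * nrm τ a := by
      intro a
      rw [hKapp]
      calc _ ≤ ∑ i, nrm τ (Q i a * h i) := nrm_sum_le _ _ _
        _ ≤ ∑ i : ι, 2⁻¹ / (Fintype.card ι + 1) * nrm τ a := by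
          refine Finset.sum_le_sum fun i _ => (nrm_mul_le _ _ _).trans ?_
          calc _ ≤ nrm τ (Q i a) * (2⁻¹ / (Fintype.card ι + 1) * wt τ (e i)) := by
                gcongr; exact hτ i
            _ = 2⁻¹ / (Fintype.card ι + 1) * (nrm τ (Q i a) * wt τ (e i)) := by ring
            _ ≤ _ := by gcongr; exact nrm_shiftPart_mul_le _ _ _ _
        _ = (Fintype.card ι * (2⁻¹ / (Fintype.card ι + 1))) * nrm τ a := by
          rw [Finset.sum_const, nsmul_eq_mul, Finset.card_univ, mul_assoc]
        _ ≤ _ := by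
          gcongr
          calc (Fintype.card ι * (2⁻¹ / (Fintype.card ι + 1)) : ℝ≥0∞)
              ≤ (Fintype.card ι + 1) * (2⁻¹ / (Fintype.card ι + 1)) := by
                gcongr; exact le_self_add
            _ ≤ 2⁻¹ := ENNReal.mul_div_le
    have hKm : ∀ m, nrm τ ((K ^ m) f) ≤ 2⁻¹ ^ m * nrm τ f := by
      intro m
      induction m with
      | zero => simp
      | succ m ih =>
        rw [pow_succ' K, Module.End.mul_apply]
        refine (hKn _).trans ?_
        rw [pow_succ', mul_assoc]
        gcongr
    have hVn : ∀ M, nrm τ (V M) ≤ 2 * nrm τ f := by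
      intro M
      refine (nrm_sum_le _ _ _).trans ((Finset.sum_le_sum fun m _ => hKm m).trans ?_)
      rw [← Finset.sum_mul]
      gcongr
      exact (ENNReal.sum_le_tsum _).trans (by rw [ENNReal.tsum_geometric]; simp)
    refine ⟨τ, ne_top_of_le_ne_top (ENNReal.mul_ne_top (a := 2) (b := nrm τ f) ENNReal.ofNat_ne_top hfτ) ?_⟩
    rw [nrm, ENNReal.tsum_eq_iSup_sum]
    refine iSup_le fun S => ?_
    refine le_trans ?_ (hVn (S.sup size + 1))
    refine le_trans (le_of_eq ?_) (ENNReal.sum_le_tsum S)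
    refine Finset.sum_congr rfl fun α hα => ?_
    rw [huV _ α (Nat.lt_succ_of_le (Finset.le_sup hα))]
  have hQc : ∀ i, Q i u ∈ convSeries n := by
    obtain ⟨τ, hτ⟩ := huc
    refine fun i => ⟨τ, fun htop => ?_⟩
    have := nrm_shiftPart_mul_le τ (fun α => sel α = some i) (e i) u
    rw [show shiftPart (fun α => sel α = some i) (e i) u = Q i u from rfl, htop,
      ENNReal.top_mul (wt_ne_zero _ _)] at this
    exact hτ (top_le_iff.1 this)
  refine ⟨fun i => Q i u, f - ∑ i, Q i u * g i, hQc, by ring, fun α i hi => ?_⟩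
  have : f - ∑ i, Q i u * g i = u - ∑ i, Q i u * MvPowerSeries.monomial (e i) 1 := by
    rw [← hfix, hKapp]
    simp only [hh, mul_sub, Finset.sum_sub_distrib]
    ring
  rw [this, map_sub, map_sum]
  simp_rw [hQ, coeff_shiftPart_mul_monomial _ _ (fun α h => hsel1 α _ h)]
  obtain ⟨j, hj⟩ : ∃ j, sel α = some j := by
    rcases h : sel α with _ | j
    · exact absurd hi (hsel2 α h i)
    · exact ⟨j, rfl⟩
  simp [hj]

instance : IsNoetherianRing (convSeries n) := by
  classical
  refine isNoetherianRing_iff_ideal_fg _ |>.2 fun I => ?_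
  let lead : (Fin n →₀ ℕ) → Prop := fun e => ∃ g ∈ I, MvPowerSeries.coeff e g.1 = 1 ∧
    ∀ α, size α ≤ size e → α ≠ e → MvPowerSeries.coeff α g.1 = 0
  let T : Set (Fin n →₀ ℕ) := {e | Minimal lead e}
  have hT : T.Finite := WellQuasiOrderedLE.finite_of_isAntichain (setOfPred_minimal_antichain lead)
  have : Fintype T := hT.fintype
  have hmem : ∀ e : T, lead e := fun e => e.2.prop
  choose g hgI hg1 hg2 using hmem
  refine ⟨Finset.univ.image g, le_antisymm (Submodule.span_le.2 ?_) fun f hf => ?_⟩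
  · rintro _ hx
    simp only [Finset.coe_image, Finset.coe_univ, Set.image_univ, Set.mem_range] at hx
    obtain ⟨e, rfl⟩ := hx
    exact hgI e
  obtain ⟨q, r, hq, hfr, hr⟩ := division (fun e : T => (g e).1) (fun e => e.1) (fun e => (g e).2)
    hg1 hg2 f.1 f.2
  have hsum : f.1 - r = (∑ e, (⟨q e, hq e⟩ : convSeries n) * g e : convSeries n).1 := by
    rw [hfr]; simp
  have hrc : r ∈ convSeries n := by
    have : r = f.1 - (f.1 - r) := by ring
    rw [this, hsum]
    exact sub_mem f.2 (Subtype.property _)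
  have hfeq : f = ∑ e, (⟨q e, hq e⟩ : convSeries n) * g e + ⟨r, hrc⟩ := by
    apply Subtype.ext
    rw [Subring.coe_add, ← hsum]
    simp
  have hrI : (⟨r, hrc⟩ : convSeries n) ∈ I := by
    have h1 : ∑ e, (⟨q e, hq e⟩ : convSeries n) * g e ∈ I :=
      I.sum_mem fun e _ => I.mul_mem_left _ (hgI e)
    rw [hfeq] at hf
    exact (I.add_mem_iff_right h1).1 hf
  have hr0 : r = 0 := by
    by_contra hne
    obtain ⟨α₀, hα₀⟩ : ∃ α, MvPowerSeries.coeff α r ≠ 0 := by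
      by_contra! hcon
      exact hne (MvPowerSeries.ext hcon)
    obtain ⟨α, hα, hαmin⟩ := exists_minimalFor_of_wellFoundedLT
      (fun α => MvPowerSeries.coeff α r ≠ 0) size ⟨α₀, hα₀⟩
    have hlead : lead α := by
      have hC : MvPowerSeries.C (MvPowerSeries.coeff α r)⁻¹ ∈ convSeries n := by
        refine ⟨0, ?_⟩
        rw [← MvPowerSeries.monomial_zero_eq_C_apply, nrm_monomial]
        exact ENNReal.mul_ne_top (by simp) (wt_ne_top _ _)
      refine ⟨⟨_, hC⟩ * ⟨r, hrc⟩, I.mul_mem_left _ hrI, ?_, ?_⟩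
      · simp [hα]
      · intro β hβ hβα
        simp only [Subring.coe_mul, MvPowerSeries.coeff_C_mul, mul_eq_zero, inv_eq_zero]
        right
        by_contra hβ0
        exact hβα (size_injective (le_antisymm hβ (hαmin hβ0 hβ)))
    obtain ⟨e, heα, he⟩ := exists_minimal_le_of_wellFoundedLT lead α hlead
    exact hα (hr α ⟨e, he⟩ heα)
  rw [hfeq]
  have hr0' : (⟨r, hrc⟩ : convSeries n) = 0 := Subtype.ext hr0
  rw [hr0', add_zero]
  refine Submodule.sum_mem _ fun e _ => ?_
  exact Ideal.mul_mem_left _ _ (Ideal.subset_span (by simp))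

/-- A convergent series without constant term lies in the ideal generated by the variables. -/
lemma exists_eq_sum_mul_X (f : MvPowerSeries (Fin n) ℝ) (hf : f ∈ convSeries n)
    (h0 : MvPowerSeries.coeff 0 f = 0) : ∃ q : Fin n → MvPowerSeries (Fin n) ℝ,
      (∀ i, q i ∈ convSeries n) ∧ f = ∑ i, q i * MvPowerSeries.X i := by
  classical
  obtain ⟨q, r, hq, hfr, hr⟩ := division (fun i : Fin n => MvPowerSeries.X i)
    (fun i => Finsupp.single i 1) (fun i => ⟨0, by
      rw [MvPowerSeries.X, nrm_monomial]; exact ENNReal.mul_ne_top (by simp) (wt_ne_top _ _)⟩)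
    (fun i => by simp) (fun i α _ hα => by rw [MvPowerSeries.coeff_X, if_neg hα]) f hf
  refine ⟨q, hq, ?_⟩
  have hr0 : r = 0 := by
    ext α
    by_cases hα : α = 0
    · subst hα
      rw [hfr, map_add, map_sum] at h0
      simpa using h0
    · obtain ⟨i, hi⟩ := Finsupp.ne_iff.1 hα
      simpa using hr α i (by simpa [Nat.one_le_iff_ne_zero] using hi)
  rw [hfr, hr0, add_zero]

lemma two_pow_le_size (α : Fin n →₀ ℕ) : 2 ^ α.degree ≤ size α := by
  rw [Finsupp.degree_apply, ← Finset.prod_pow_eq_pow_sum]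
  exact Finset.prod_le_prod' fun i _ => Nat.pow_le_pow_left (prime_nth i).two_le _

lemma size_le_pow (α : Fin n →₀ ℕ) : size α ≤ (∏ i : Fin n, Nat.nth Nat.Prime i) ^ α.degree := by
  rw [Finsupp.degree_apply, ← Finset.prod_pow_eq_pow_sum]
  refine Finset.prod_le_prod' fun i _ => Nat.pow_le_pow_left ?_ _
  exact Nat.le_of_dvd (Finset.prod_pos fun i _ => (prime_nth i).pos)
    (Finset.dvd_prod_of_mem (fun i : Fin n => Nat.nth Nat.Prime i) (Finset.mem_univ i))

lemma exists_radius (n τ : ℕ) : ∃ R : ℝ≥0, 0 < R ∧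
    ∀ α : Fin n →₀ ℕ, (R : ℝ≥0∞) ^ α.degree ≤ wt τ α := by
  have hB : 0 < ∏ i : Fin n, Nat.nth Nat.Prime i := Finset.prod_pos fun i _ => (prime_nth i).pos
  refine ⟨(((∏ i : Fin n, Nat.nth Nat.Prime i : ℕ) : ℝ≥0)⁻¹) ^ τ, by positivity, fun α => ?_⟩
  rw [wt, ENNReal.coe_pow, ENNReal.coe_inv (by exact_mod_cast hB.ne'), ← pow_mul, mul_comm τ,
    pow_mul]
  gcongr
  rw [← ENNReal.inv_pow, ENNReal.inv_le_inv]
  exact_mod_cast size_le_pow α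

/-- Evaluation of a monomial. -/
noncomputable def mono (x : Fin n → ℝ) (α : Fin n →₀ ℕ) : ℝ := α.prod fun i k => x i ^ k

lemma mono_add (x : Fin n → ℝ) (α β : Fin n →₀ ℕ) : mono x (α + β) = mono x α * mono x β :=
  Finsupp.prod_add_index' (by simp) (fun _ _ _ => pow_add _ _ _)

lemma enorm_mono_le {R : ℝ≥0} {x : Fin n → ℝ} (hx : ‖x‖ ≤ R) (α : Fin n →₀ ℕ) :
    ‖mono x α‖ₑ ≤ (R : ℝ≥0∞) ^ α.degree := by
  have h : ‖mono x α‖ ≤ (R : ℝ) ^ α.degree := by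
    rw [mono, Finsupp.prod, norm_prod, Finsupp.degree_apply, ← Finset.prod_pow_eq_pow_sum]
    refine Finset.prod_le_prod (fun _ _ => norm_nonneg _) fun i _ => ?_
    rw [norm_pow]
    exact pow_le_pow_left₀ (norm_nonneg _) ((norm_le_pi_norm x i).trans hx) _
  rw [← ENNReal.coe_pow, enorm_le_coe]
  exact_mod_cast h

/-- The sum of a power series. -/
noncomputable def evalFn (a : MvPowerSeries (Fin n) ℝ) (x : Fin n → ℝ) : ℝ :=
  ∑' α, MvPowerSeries.coeff α a * mono x α

lemma summable_norm {τ : ℕ} {R : ℝ≥0} (hR : ∀ α : Fin n →₀ ℕ, (R : ℝ≥0∞) ^ α.degree ≤ wt τ α)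
    {a : MvPowerSeries (Fin n) ℝ} (ha : nrm τ a ≠ ⊤) {x : Fin n → ℝ} (hx : ‖x‖ ≤ R) :
    Summable fun α => ‖MvPowerSeries.coeff α a * mono x α‖ := by
  refine Summable.norm (Summable.of_enorm (ne_top_of_le_ne_top ha ?_))
  refine ENNReal.tsum_le_tsum fun α => ?_
  rw [enorm_mul]
  gcongr
  exact (enorm_mono_le hx α).trans (hR α)

lemma eventually_summable_norm {a : MvPowerSeries (Fin n) ℝ} (ha : a ∈ convSeries n) :
    ∀ᶠ x : Fin n → ℝ in 𝓝 0, Summable fun α => ‖MvPowerSeries.coeff α a * mono x α‖ := by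
  obtain ⟨τ, hτ⟩ := ha
  obtain ⟨R, hR0, hR⟩ := exists_radius n τ
  filter_upwards [Metric.closedBall_mem_nhds (0 : Fin n → ℝ) (show (0 : ℝ) < R by exact_mod_cast hR0)]
    with x hx
  exact summable_norm hR hτ (by simpa using hx)

lemma exists_multilinear_eq_mono (k : ℕ) (α : Fin n →₀ ℕ) :
    ∃ M : ContinuousMultilinearMap ℝ (fun _ : Fin k => Fin n → ℝ) ℝ, ‖M‖ ≤ 1 ∧
      (α.degree = k → ∀ x, M (fun _ => x) = mono x α) := by
  by_cases h : α.degree = k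
  swap
  · exact ⟨0, by simp, fun h' => absurd h' h⟩
  have hl : (Finsupp.toMultiset α).toList.length = k := by
    rw [Multiset.length_toList, Finsupp.card_toMultiset, ← h, Finsupp.degree_apply]
    rfl
  set l := (Finsupp.toMultiset α).toList with hldef
  refine ⟨(ContinuousMultilinearMap.mkPiAlgebraFin ℝ k ℝ).compContinuousLinearMap
    fun j => ContinuousLinearMap.proj (l.get (j.cast hl.symm)), ?_, fun _ x => ?_⟩
  · refine (ContinuousMultilinearMap.norm_compContinuousLinearMap_le _ _).trans ?_
    rw [ContinuousMultilinearMap.norm_mkPiAlgebraFin, one_mul]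
    refine Finset.prod_le_one (fun _ _ => norm_nonneg _) fun j _ => ?_
    exact ContinuousLinearMap.opNorm_le_bound _ zero_le_one fun x => by
      rw [one_mul]; exact norm_le_pi_norm x _
  · simp only [ContinuousMultilinearMap.compContinuousLinearMap_apply,
      ContinuousMultilinearMap.mkPiAlgebraFin_apply, ContinuousLinearMap.proj_apply]
    have : (List.ofFn fun j : Fin k => x (l.get (j.cast hl.symm))) = l.map x := by
      subst hl
      simp [List.ofFn_getElem_eq_map]
    rw [this, ← Multiset.prod_coe, ← Multiset.map_coe, hldef, Multiset.coe_toList,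
      Finsupp.toMultiset_map, Finsupp.prod_toMultiset,
      Finsupp.prod_mapDomain_index (by simp) (fun _ _ _ => pow_add _ _ _)]
    rfl

lemma analyticAt_evalFn {a : MvPowerSeries (Fin n) ℝ} (ha : a ∈ convSeries n) :
    AnalyticAt ℝ (evalFn a) 0 := by
  obtain ⟨τ, hτ⟩ := ha
  obtain ⟨R, hR0, hR⟩ := exists_radius n τ
  choose M hM1 hM using fun k => exists_multilinear_eq_mono (n := n) k
  let p : FormalMultilinearSeries ℝ (Fin n → ℝ) ℝ := fun k =>
    ∑ α ∈ Finset.univ.finsuppAntidiag k, MvPowerSeries.coeff α a • M k α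
  have hmem : ∀ k (α : Fin n →₀ ℕ), α ∈ Finset.univ.finsuppAntidiag k ↔ α.degree = k := by
    intro k α
    simp [Finset.mem_finsuppAntidiag, Finsupp.degree_eq_sum]
  refine ⟨p, R, ?_, by exact_mod_cast hR0, ?_⟩
  · refine p.le_radius_of_bound (nrm τ a).toReal fun k => ?_
    have : ‖p k‖ₑ * (R : ℝ≥0∞) ^ k ≤ nrm τ a := by
      calc ‖p k‖ₑ * (R : ℝ≥0∞) ^ k ≤ (∑ α ∈ Finset.univ.finsuppAntidiag k,
            ‖MvPowerSeries.coeff α a‖ₑ) * (R : ℝ≥0∞) ^ k := by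
            gcongr
            refine (enorm_sum_le (Finset.univ.finsuppAntidiag k)
              (fun α => MvPowerSeries.coeff α a • M k α)).trans (Finset.sum_le_sum fun α _ => ?_)
            rw [enorm_smul]
            refine mul_le_of_le_one_right' ?_
            have := hM1 k α
            rw [← enorm_norm, ← ENNReal.ofReal_one, Real.enorm_of_nonneg (norm_nonneg _)]
            exact ENNReal.ofReal_le_ofReal this
        _ ≤ ∑ α ∈ Finset.univ.finsuppAntidiag k, ‖MvPowerSeries.coeff α a‖ₑ * wt τ α := by
            rw [Finset.sum_mul]
            refine Finset.sum_le_sum fun α hα => ?_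
            gcongr
            rw [← (hmem k α).1 hα]
            exact hR α
        _ ≤ nrm τ a := ENNReal.sum_le_tsum _
    have h2 := ENNReal.toReal_mono hτ this
    simpa using h2
  · intro x hx
    have hx' : ‖x‖ ≤ R := by
      have := (Metric.mem_eball.1 hx).le
      rw [edist_zero_right, enorm_le_coe] at this
      exact_mod_cast this
    have hs := (summable_norm hR hτ hx').of_norm.hasSum.tsum_fiberwise
      (fun α : Fin n →₀ ℕ => α.degree)
    rw [zero_add]
    change HasSum _ (∑' α, MvPowerSeries.coeff α a * mono x α)
    refine (congrArg (fun g => HasSum g _) (funext fun k => ?_)).mpr hs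
    have hset : (fun α : Fin n →₀ ℕ => α.degree) ⁻¹' {k} =
        ↑((Finset.univ : Finset (Fin n)).finsuppAntidiag k) := by
      ext α
      simp only [Set.mem_preimage, Set.mem_singleton_iff, Finset.mem_coe, hmem]
    rw [hset, Finset.tsum_subtype' _ (fun α => MvPowerSeries.coeff α a * mono x α)]
    change (∑ α ∈ _, MvPowerSeries.coeff α a • M k α) _ = _
    rw [_root_.sum_apply]
    refine Finset.sum_congr rfl fun α hα => ?_
    rw [_root_.smul_apply, hM k α ((hmem k α).1 hα), smul_eq_mul]

/-- The exponent of the commutative image of a word. -/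
noncomputable def wordExp (w : Σ k : ℕ, Fin k → Fin n) : Fin n →₀ ℕ :=
  ∑ j, Finsupp.single (w.2 j) 1

lemma degree_wordExp (w : Σ k : ℕ, Fin k → Fin n) : (wordExp w).degree = w.1 := by
  simp [wordExp, map_sum]

lemma mono_wordExp (x : Fin n → ℝ) (w : Σ k : ℕ, Fin k → Fin n) :
    mono x (wordExp w) = ∏ j, x (w.2 j) := by
  have h : ∀ s : Finset (Fin w.1), mono x (∑ j ∈ s, Finsupp.single (w.2 j) 1) =
      ∏ j ∈ s, x (w.2 j) := by
    intro s
    classical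
    induction s using Finset.induction_on with
    | empty => simp [mono]
    | insert i s hi ih =>
      rw [Finset.sum_insert hi, Finset.prod_insert hi, mono_add, ih]
      congr 1
      simp [mono]
  exact h _

lemma apply_eq_sum_words {k : ℕ} (M : ContinuousMultilinearMap ℝ (fun _ : Fin k => Fin n → ℝ) ℝ)
    (x : Fin n → ℝ) :
    M (fun _ => x) = ∑ w : Fin k → Fin n, M (fun j => Pi.single (w j) 1) * mono x (wordExp ⟨k, w⟩) := by
  have hx : x = ∑ i, x i • (Pi.single i 1 : Fin n → ℝ) := by
    ext j; simp [Finset.sum_apply, Pi.single_apply]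
  conv_lhs => rw [hx]
  rw [ContinuousMultilinearMap.map_sum]
  refine Finset.sum_congr rfl fun w _ => ?_
  rw [ContinuousMultilinearMap.map_smul_univ, mono_wordExp, smul_eq_mul, mul_comm]

lemma exists_evalFn_eq {f : (Fin n → ℝ) → ℝ} (hf : AnalyticAt ℝ f 0) :
    ∃ a ∈ convSeries n, f =ᶠ[𝓝 0] evalFn a := by
  obtain ⟨p, ρ, hp⟩ := hf
  obtain ⟨r, hr0, hrρ⟩ := ENNReal.lt_iff_exists_nnreal_btwn.1 hp.r_pos
  obtain ⟨C, hC0, hC⟩ := p.norm_mul_pow_le_of_lt_radius (hrρ.trans_le hp.r_le)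
  have hr0' : (0 : ℝ) < r := by exact_mod_cast hr0
  let c : (Σ k : ℕ, Fin k → Fin n) → ℝ := fun w => p w.1 fun j => Pi.single (w.2 j) 1
  have hc : ∀ w, ‖c w‖ ≤ ‖p w.1‖ := fun w => by
    refine (ContinuousMultilinearMap.le_opNorm _ _).trans (mul_le_of_le_one_right (norm_nonneg _) ?_)
    refine Finset.prod_le_one (fun _ _ => norm_nonneg _) fun j _ => ?_
    rw [Pi.norm_single]; simp
  obtain ⟨τ, hτ⟩ : ∃ τ : ℕ, (n : ℝ) * ((2 : ℝ)⁻¹) ^ τ ≤ r / 2 := by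
    have ht : Tendsto (fun τ : ℕ => (n : ℝ) * ((2 : ℝ)⁻¹) ^ τ) atTop (𝓝 0) := by
      simpa using (tendsto_pow_atTop_nhds_zero_of_lt_one (r := (2 : ℝ)⁻¹) (by norm_num)
        (by norm_num)).const_mul (n : ℝ)
    exact (ht.eventually (ge_mem_nhds (half_pos hr0'))).exists
  have hS : ∑' w, ‖c w‖ₑ * wt τ (wordExp w) ≠ ⊤ := by
    rw [ENNReal.tsum_sigma']
    have hle : ∀ k : ℕ, ∑' w : Fin k → Fin n, ‖c ⟨k, w⟩‖ₑ * wt τ (wordExp ⟨k, w⟩) ≤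
        ENNReal.ofReal (C * (1 / 2) ^ k) := by
      intro k
      have hw : ∀ w : Fin k → Fin n, wt τ (wordExp ⟨k, w⟩) ≤
          ENNReal.ofReal ((((2 : ℝ)⁻¹) ^ τ) ^ k) := by
        intro w
        rw [wt, ← pow_mul, mul_comm τ, pow_mul, ENNReal.ofReal_pow (by positivity)]
        gcongr
        rw [inv_pow, ENNReal.ofReal_inv_of_pos (by positivity), ENNReal.inv_le_inv,
          ENNReal.ofReal_pow (by norm_num)]
        have h2 := two_pow_le_size (wordExp (⟨k, w⟩ : Σ k : ℕ, Fin k → Fin n))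
        rw [degree_wordExp] at h2
        calc ENNReal.ofReal 2 ^ k = ((2 ^ k : ℕ) : ℝ≥0∞) := by simp
          _ ≤ _ := by exact_mod_cast h2
      calc _ ≤ ∑' w : Fin k → Fin n, ENNReal.ofReal ‖p k‖ * ENNReal.ofReal ((((2 : ℝ)⁻¹) ^ τ) ^ k) := by
            refine ENNReal.tsum_le_tsum fun w => mul_le_mul' ?_ (hw w)
            rw [← ofReal_norm]
            exact ENNReal.ofReal_le_ofReal (hc ⟨k, w⟩)
        _ = ENNReal.ofReal (‖p k‖ * (n * ((2 : ℝ)⁻¹) ^ τ) ^ k) := by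
            rw [tsum_fintype, Finset.sum_const, Finset.card_univ, Fintype.card_fun,
              Fintype.card_fin, Fintype.card_fin, ← ENNReal.ofReal_mul (norm_nonneg _),
              ← ENNReal.ofReal_nsmul]
            congr 1
            rw [nsmul_eq_mul]; push_cast; ring
        _ ≤ _ := by
            refine ENNReal.ofReal_le_ofReal ?_
            calc ‖p k‖ * (n * ((2 : ℝ)⁻¹) ^ τ) ^ k ≤ ‖p k‖ * (r / 2) ^ k := by gcongr
              _ = (‖p k‖ * r ^ k) * (1 / 2) ^ k := by rw [div_pow, div_pow, one_pow]; ring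
              _ ≤ C * (1 / 2) ^ k := by gcongr; exact hC k
    refine ne_top_of_le_ne_top ?_ (ENNReal.tsum_le_tsum hle)
    refine Summable.tsum_ofReal_ne_top ?_
    exact (summable_geometric_of_lt_one (by norm_num) (by norm_num)).mul_left C
  let a : MvPowerSeries (Fin n) ℝ := fun α => ∑' w : wordExp ⁻¹' {α}, c w
  have hcoeff : ∀ α, MvPowerSeries.coeff α a = ∑' w : wordExp ⁻¹' {α}, c w := fun α => rfl
  have ha : nrm τ a ≠ ⊤ := by
    refine ne_top_of_le_ne_top hS ?_
    rw [← ENNReal.tsum_fiberwise _ wordExp, nrm]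
    refine ENNReal.tsum_le_tsum fun α => ?_
    rw [hcoeff]
    calc _ ≤ (∑' w : wordExp ⁻¹' {α}, ‖c w‖ₑ) * wt τ α := by
          gcongr; exact enorm_tsum_le_tsum_enorm
      _ = _ := by
          rw [← ENNReal.tsum_mul_right]
          refine tsum_congr fun w => ?_
          rw [show wordExp w.1 = α from w.2]
  refine ⟨a, ⟨τ, ha⟩, ?_⟩
  obtain ⟨R, hR0, hR⟩ := exists_radius n τ
  filter_upwards [Metric.closedBall_mem_nhds (0 : Fin n → ℝ)
    (show (0 : ℝ) < R by exact_mod_cast hR0), Metric.eball_mem_nhds (0 : Fin n → ℝ) hp.r_pos] with x hx hxρ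
  have hx' : ‖x‖ ≤ R := by simpa using hx
  have hsum : Summable fun w => c w * mono x (wordExp w) := by
    refine Summable.of_enorm (ne_top_of_le_ne_top hS (ENNReal.tsum_le_tsum fun w => ?_))
    rw [enorm_mul]
    gcongr
    exact (enorm_mono_le hx' _).trans (hR _)
  have h1 : HasSum (fun k => p k fun _ => x) (∑' w, c w * mono x (wordExp w)) := by
    refine hsum.hasSum.sigma fun k => ?_
    rw [apply_eq_sum_words]
    exact hasSum_fintype _
  have h2 := hp.hasSum hxρ
  rw [zero_add] at h2
  rw [h2.unique h1, evalFn, ← (hsum.hasSum.tsum_fiberwise wordExp).tsum_eq]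
  refine tsum_congr fun α => ?_
  rw [hcoeff, ← tsum_mul_right]
  refine tsum_congr fun w => ?_
  rw [show wordExp w.1 = α from w.2]

lemma evalFn_monomial (e : Fin n →₀ ℕ) (c : ℝ) (x : Fin n → ℝ) :
    evalFn (MvPowerSeries.monomial e c) x = c * mono x e := by
  classical
  rw [evalFn, tsum_eq_single e]
  · simp
  · intro β hβ
    simp [MvPowerSeries.coeff_monomial, hβ]

lemma evalFn_mul {a b : MvPowerSeries (Fin n) ℝ} {x : Fin n → ℝ}
    (ha : Summable fun α => ‖MvPowerSeries.coeff α a * mono x α‖)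
    (hb : Summable fun α => ‖MvPowerSeries.coeff α b * mono x α‖) :
    evalFn (a * b) x = evalFn a x * evalFn b x := by
  classical
  obtain ⟨f, hf⟩ : ∃ f, f = fun α => MvPowerSeries.coeff α a * mono x α := ⟨_, rfl⟩
  obtain ⟨g, hg⟩ : ∃ g, g = fun α => MvPowerSeries.coeff α b * mono x α := ⟨_, rfl⟩
  have hf' : Summable fun α => ‖f α‖ := by rwa [hf]
  have hg' : Summable fun α => ‖g α‖ := by rwa [hg]
  have key := hf'.of_norm.tsum_mul_tsum_eq_tsum_sum_antidiagonal hg'.of_norm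
    (summable_mul_of_summable_norm hf' hg')
  have h2 : evalFn a x * evalFn b x = (∑' α, f α) * ∑' α, g α := by rw [hf, hg]; rfl
  rw [h2, key, evalFn]
  refine tsum_congr fun α => ?_
  rw [MvPowerSeries.coeff_mul, Finset.sum_mul]
  refine Finset.sum_congr rfl fun γ hγ => ?_
  rw [← Finset.HasAntidiagonal.mem_antidiagonal.1 hγ, mono_add, hf, hg]
  ring

/-- The germ at the origin of the sum of a convergent power series. -/
noncomputable def toGerm (n : ℕ) : convSeries n →+* Germ (𝓝 (0 : Fin n → ℝ)) ℝ where
  toFun a := Germ.ofFun (evalFn a.1)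
  map_one' := by
    rw [← Germ.coe_one, Germ.coe_eq]
    refine Eventually.of_forall fun x => ?_
    change evalFn (1 : MvPowerSeries (Fin n) ℝ) x = 1
    rw [← MvPowerSeries.monomial_zero_one, evalFn_monomial]
    simp [mono]
  map_zero' := by
    rw [← Germ.coe_zero, Germ.coe_eq]
    exact Eventually.of_forall fun x => by simp [evalFn]
  map_add' a b := by
    rw [← Germ.coe_add, Germ.coe_eq]
    filter_upwards [eventually_summable_norm a.2, eventually_summable_norm b.2] with x ha hb
    simp only [evalFn, Pi.add_apply, Subring.coe_add, map_add, add_mul]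
    exact ha.of_norm.tsum_add hb.of_norm
  map_mul' a b := by
    rw [← Germ.coe_mul]
    refine Germ.coe_eq.2 ?_
    filter_upwards [eventually_summable_norm a.2, eventually_summable_norm b.2] with x ha hb
    exact evalFn_mul ha hb

end ConvSeries

open ConvSeries

/-- The ring of germs at the origin of real analytic functions. -/
def analyticGerms (n : ℕ) : Subring (Germ (𝓝 (0 : Fin n → ℝ)) ℝ) where
  carrier := {g | ∃ f : (Fin n → ℝ) → ℝ, AnalyticAt ℝ f 0 ∧ Germ.ofFun f = g}
  zero_mem' := ⟨0, analyticAt_const, rfl⟩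
  one_mem' := ⟨1, analyticAt_const, rfl⟩
  add_mem' := by
    rintro _ _ ⟨f, hf, rfl⟩ ⟨g, hg, rfl⟩
    exact ⟨f + g, hf.add hg, rfl⟩
  mul_mem' := by
    rintro _ _ ⟨f, hf, rfl⟩ ⟨g, hg, rfl⟩
    exact ⟨f * g, hf.mul hg, rfl⟩
  neg_mem' := by
    rintro _ ⟨f, hf, rfl⟩
    exact ⟨-f, hf.neg, rfl⟩

namespace analyticGerms

variable {n : ℕ}

lemma range_toGerm (n : ℕ) : (toGerm n).range = analyticGerms n := by
  ext g
  constructor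
  · rintro ⟨a, rfl⟩
    exact ⟨_, analyticAt_evalFn a.2, rfl⟩
  · rintro ⟨f, hf, rfl⟩
    obtain ⟨a, ha, hfa⟩ := exists_evalFn_eq hf
    exact ⟨⟨a, ha⟩, (Germ.coe_eq.2 hfa).symm⟩

instance : IsNoetherianRing (analyticGerms n) := by
  rw [← range_toGerm]
  exact isNoetherianRing_range _

/-- The germ of an analytic function. -/
def mk (f : (Fin n → ℝ) → ℝ) (hf : AnalyticAt ℝ f 0) : analyticGerms n := ⟨Germ.ofFun f, f, hf, rfl⟩

/-- A function representing a germ. -/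
noncomputable def rep (g : analyticGerms n) : (Fin n → ℝ) → ℝ := g.2.choose

lemma analyticAt_rep (g : analyticGerms n) : AnalyticAt ℝ (rep g) 0 := g.2.choose_spec.1

lemma coe_rep (g : analyticGerms n) : Germ.ofFun (rep g) = g.1 := g.2.choose_spec.2

lemma ext_rep {g h : analyticGerms n} (H : rep g =ᶠ[𝓝 0] rep h) : g = h :=
  Subtype.ext (by rw [← coe_rep, ← coe_rep]; exact Germ.coe_eq.2 H)

lemma rep_mk (f : (Fin n → ℝ) → ℝ) (hf : AnalyticAt ℝ f 0) : rep (mk f hf) =ᶠ[𝓝 0] f :=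
  Germ.coe_eq.1 (coe_rep (mk f hf))

lemma rep_add (g h : analyticGerms n) : rep (g + h) =ᶠ[𝓝 0] rep g + rep h :=
  Germ.coe_eq.1 (by rw [coe_rep, Germ.coe_add, coe_rep, coe_rep]; rfl)

lemma rep_mul (g h : analyticGerms n) : rep (g * h) =ᶠ[𝓝 0] rep g * rep h :=
  Germ.coe_eq.1 (by rw [coe_rep, Germ.coe_mul, coe_rep, coe_rep]; rfl)

lemma rep_zero : rep (0 : analyticGerms n) =ᶠ[𝓝 0] 0 :=
  Germ.coe_eq.1 (by rw [coe_rep]; rfl)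

lemma rep_one : rep (1 : analyticGerms n) =ᶠ[𝓝 0] 1 :=
  Germ.coe_eq.1 (by rw [coe_rep]; rfl)

lemma rep_sum {ι : Type*} (s : Finset ι) (g : ι → analyticGerms n) :
    rep (∑ i ∈ s, g i) =ᶠ[𝓝 0] fun x => ∑ i ∈ s, rep (g i) x := by
  classical
  induction s using Finset.induction_on with
  | empty => exact rep_zero.trans (Eventually.of_forall fun x => by simp)
  | insert i s hi ih =>
    simp only [Finset.sum_insert hi]
    refine (rep_add _ _).trans ?_
    filter_upwards [ih] with x hx
    simp [hx]

lemma analyticAt_fderiv_rep (i : Fin n) (g : analyticGerms n) :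
    AnalyticAt ℝ (fun x => fderiv ℝ (rep g) x (Pi.single i 1)) 0 :=
  ((ContinuousLinearMap.apply ℝ ℝ (Pi.single i 1 : Fin n → ℝ)).analyticAt _).comp
    (analyticAt_rep g).fderiv

lemma eventually_differentiableAt_rep (g : analyticGerms n) :
    ∀ᶠ x in 𝓝 0, DifferentiableAt ℝ (rep g) x :=
  (analyticAt_rep g).eventually_analyticAt.mono fun _ h => h.differentiableAt

/-- The partial derivative of a germ, as an additive map. -/
noncomputable def pdHom (i : Fin n) : analyticGerms n →+ analyticGerms n where
  toFun g := mk _ (analyticAt_fderiv_rep i g)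
  map_zero' := by
    refine ext_rep (((rep_mk _ _).trans ?_).trans rep_zero.symm)
    filter_upwards [(rep_zero (n := n)).fderiv (𝕜 := ℝ)] with x hx
    rw [hx]; simp
  map_add' g h := by
    refine ext_rep (((rep_mk _ _).trans ?_).trans (rep_add _ _).symm)
    filter_upwards [(rep_add g h).fderiv (𝕜 := ℝ), rep_mk _ (analyticAt_fderiv_rep i g),
      rep_mk _ (analyticAt_fderiv_rep i h), eventually_differentiableAt_rep g,
      eventually_differentiableAt_rep h] with x h1 h2 h3 h4 h5
    rw [h1, Pi.add_apply, h2, h3, fderiv_add h4 h5]; rfl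

lemma rep_pdHom (i : Fin n) (g : analyticGerms n) :
    rep (pdHom i g) =ᶠ[𝓝 0] fun x => fderiv ℝ (rep g) x (Pi.single i 1) :=
  rep_mk _ (analyticAt_fderiv_rep i g)

/-- The partial derivative of a germ. -/
noncomputable def pd (i : Fin n) : Derivation ℤ (analyticGerms n) (analyticGerms n) :=
  Derivation.mk' (pdHom i).toIntLinearMap fun g h => by
    change pdHom i (g * h) = g * pdHom i h + h * pdHom i g
    refine ext_rep (((rep_pdHom _ _).trans ?_).trans (rep_add _ _).symm)
    filter_upwards [(rep_mul g h).fderiv (𝕜 := ℝ), rep_pdHom i g, rep_pdHom i h,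
      eventually_differentiableAt_rep g, eventually_differentiableAt_rep h,
      rep_mul g (pdHom i h), rep_mul h (pdHom i g)] with x h1 h2 h3 h4 h5 h6 h7
    rw [h1, Pi.add_apply, fderiv_mul h4 h5, h6, h7, Pi.mul_apply, Pi.mul_apply, h2, h3]
    simp

lemma rep_pd (i : Fin n) (g : analyticGerms n) :
    rep (pd i g) =ᶠ[𝓝 0] fun x => fderiv ℝ (rep g) x (Pi.single i 1) :=
  rep_mk _ (analyticAt_fderiv_rep i g)

lemma isUnit_natCast {k : ℕ} (hk : k ≠ 0) : IsUnit (k : analyticGerms n) := by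
  have hc : ∀ k : ℕ, (k : analyticGerms n) = mk (fun _ => (k : ℝ)) analyticAt_const :=
    fun _ => Subtype.ext rfl
  refine IsUnit.of_mul_eq_one (mk (fun _ => (k : ℝ)⁻¹) analyticAt_const) ?_
  rw [hc]
  refine Subtype.ext (Germ.coe_eq.2 (Eventually.of_forall fun x => ?_))
  exact mul_inv_cancel₀ (Nat.cast_ne_zero.2 hk)

/-- The ideal of germs vanishing at the origin. -/
noncomputable def maxIdeal (n : ℕ) : Ideal (analyticGerms n) :=
  RingHom.ker (Germ.valueRingHom.comp (analyticGerms n).subtype)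

instance : (maxIdeal n).IsPrime := RingHom.ker_isPrime _

lemma mem_maxIdeal {g : analyticGerms n} : g ∈ maxIdeal n ↔ rep g 0 = 0 := by
  rw [maxIdeal, RingHom.mem_ker, RingHom.comp_apply, Subring.subtype_apply, ← coe_rep]
  rfl

/-- The coordinate germs. -/
noncomputable def coord (i : Fin n) : analyticGerms n :=
  mk (fun x => x i)
    ((ContinuousLinearMap.proj (R := ℝ) (φ := fun _ : Fin n => ℝ) i).analyticAt 0)

lemma maxIdeal_eq_span : maxIdeal n = Ideal.span (Set.range coord) := by
  refine le_antisymm (fun g hg => ?_) (Ideal.span_le.2 ?_)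
  · obtain ⟨a, ha⟩ : g.1 ∈ (toGerm n).range := by rw [range_toGerm]; exact g.2
    have h0 : MvPowerSeries.coeff 0 a.1 = 0 := by
      have h1 : rep g 0 = evalFn a.1 0 :=
        (Germ.coe_eq.1 ((coe_rep g).trans ha.symm)).self_of_nhds
      rw [mem_maxIdeal.1 hg, evalFn, tsum_eq_single 0] at h1
      · simpa [mono] using h1.symm
      · intro α hα
        obtain ⟨i, hi⟩ := Finsupp.ne_iff.1 hα
        have : mono (0 : Fin n → ℝ) α = 0 :=
          Finset.prod_eq_zero (Finsupp.mem_support_iff.2 hi) (by simpa using hi)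
        rw [this, mul_zero]
    obtain ⟨q, hq, hqa⟩ := exists_eq_sum_mul_X a.1 a.2 h0
    have hX : ∀ i : Fin n, MvPowerSeries.X i ∈ convSeries n := fun i => ⟨0, by
      rw [MvPowerSeries.X, nrm_monomial]; exact ENNReal.mul_ne_top (by simp) (wt_ne_top _ _)⟩
    have hg' : g = ∑ i, mk _ (analyticAt_evalFn (hq i)) * coord i := by
      apply Subtype.ext
      have ha' : a = ∑ i, (⟨q i, hq i⟩ : convSeries n) * ⟨MvPowerSeries.X i, hX i⟩ := by
        apply Subtype.ext; rw [hqa]; simp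
      rw [← ha, ha', map_sum, AddSubmonoidClass.coe_finsetSum]
      refine Finset.sum_congr rfl fun i _ => ?_
      rw [map_mul, Subring.coe_mul]
      congr 1
      refine Germ.coe_eq.2 (Eventually.of_forall fun x => ?_)
      change evalFn (MvPowerSeries.monomial _ _) x = _
      rw [evalFn_monomial]
      simp [mono]
    rw [hg']
    exact Ideal.sum_mem _ fun i _ => Ideal.mul_mem_left _ _ (Ideal.subset_span ⟨i, rfl⟩)
  · rintro _ ⟨i, rfl⟩
    refine mem_maxIdeal.2 ?_
    exact (rep_mk _ _).self_of_nhds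

end analyticGerms

section DifferentialIdeals

variable {O : Type*} [CommRing O]

/-- A derivation preserving an ideal preserves its minimal primes (Seidenberg). -/
lemma Derivation.map_mem_of_mem_minimalPrimes (hchar : ∀ k : ℕ, k ≠ 0 → IsUnit (k : O))
    (D : Derivation ℤ O O) {I q : Ideal O} (hI : ∀ a ∈ I, D a ∈ I) (hq : q ∈ I.minimalPrimes)
    {a : O} (ha : a ∈ q) : D a ∈ q := by
  classical
  have hqp : q.IsPrime := hq.1.1
  have hex : ∃ k : ℕ, ∃ s, s ∉ q ∧ s * a ^ k ∈ I := by
    have h1 : algebraMap O (Localization.AtPrime q) a ∈ q.map (algebraMap O _) :=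
      Ideal.mem_map_of_mem _ ha
    rw [← IsLocalization.AtPrime.radical_map_of_mem_minimalPrimes _ q I hq] at h1
    obtain ⟨k, hk⟩ := h1
    rw [← map_pow, IsLocalization.algebraMap_mem_map_algebraMap_iff q.primeCompl] at hk
    obtain ⟨s, hs, hsa⟩ := hk
    exact ⟨k, s, hs, hsa⟩
  obtain ⟨s, hs, hsk⟩ := Nat.find_spec hex
  obtain ⟨k, hk⟩ : ∃ k, Nat.find hex = k + 1 := by
    refine Nat.exists_eq_add_one_of_ne_zero fun h0 => hs (hq.1.2 ?_)
    rw [h0, pow_zero, mul_one] at hsk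
    exact hsk
  by_contra hDa
  refine Nat.find_min hex (m := k) (by omega) ⟨s * s * ((k + 1 : ℕ) : O) * D a, ?_, ?_⟩
  · intro hmem
    rcases hqp.mem_or_mem hmem with h | h
    · rcases hqp.mem_or_mem h with h | h
      · exact hs ((hqp.mem_or_mem h).elim id id)
      · exact hqp.ne_top (Ideal.eq_top_of_isUnit_mem _ h (hchar _ (by omega)))
    · exact hDa h
  · rw [hk] at hsk
    have h1 := hI _ hsk
    rw [Derivation.leibniz, Derivation.leibniz_pow, Nat.add_sub_cancel] at h1
    simp only [smul_eq_mul, nsmul_eq_mul] at h1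
    have h2 := I.sub_mem (I.mul_mem_left s h1) (I.mul_mem_left (D s) hsk)
    convert h2 using 1
    ring

/-- If `n` elements of a prime `p` have Jacobian determinant outside `p` with respect to `n`
derivations, then `p` has height at least `n`. -/
lemma Ideal.le_height_of_det_notMem (hchar : ∀ k : ℕ, k ≠ 0 → IsUnit (k : O)) {n : ℕ}
    (D : Fin n → Derivation ℤ O O) (p : Ideal O) [hp : p.IsPrime] (f : Fin n → O)
    (hf : ∀ j, f j ∈ p) (hdet : (Matrix.of fun i j => D i (f j)).det ∉ p) : (n : ℕ∞) ≤ p.height := by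
  classical
  set A : Matrix (Fin n) (Fin n) O := Matrix.of fun i j => D i (f j) with hA
  let D' : Fin n → Derivation ℤ O O := fun i => ∑ k, A.adjugate i k • D k
  have hD' : ∀ i j, D' i (f j) = if i = j then A.det else 0 := by
    intro i j
    have h := congrFun (congrFun (Matrix.adjugate_mul A) i) j
    rw [Matrix.smul_apply, Matrix.one_apply, Matrix.mul_apply] at h
    have h2 := congrFun (map_sum Derivation.coeFnAddMonoidHom
      (fun k => A.adjugate i k • D k) Finset.univ) (f j)
    rw [Finset.sum_apply] at h2
    refine h2.trans (Eq.trans ?_ (h.trans ?_))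
    · rfl
    · simp
  have key : ∀ m : ℕ, m ≤ n → ∃ q : Ideal O, q.IsPrime ∧ q ≤ p ∧ (m : ℕ∞) ≤ q.height ∧
      ∀ i : Fin n, m ≤ i → ∀ a ∈ q, D' i a ∈ q := by
    intro m
    induction m with
    | zero =>
      intro _
      obtain ⟨q, hq, hqp⟩ := Ideal.exists_minimalPrimes_le (bot_le : (⊥ : Ideal O) ≤ p)
      refine ⟨q, hq.1.1, hqp, by simp, fun i _ a ha => ?_⟩
      exact (D' i).map_mem_of_mem_minimalPrimes hchar
        (fun b hb => by rw [Ideal.mem_bot.1 hb, map_zero]; exact Ideal.zero_mem _) hq ha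
    | succ m ih =>
      intro hm
      obtain ⟨q, hq, hqp, hht, hst⟩ := ih (by omega)
      let j : Fin n := ⟨m, by omega⟩
      have hfq : f j ∉ q := fun h => hdet (hqp (by simpa [hD'] using hst j le_rfl _ h))
      have hle : q ⊔ Ideal.span {f j} ≤ p :=
        sup_le hqp ((Ideal.span_singleton_le_iff_mem _).2 (hf j))
      obtain ⟨q', hq', hq'p⟩ := Ideal.exists_minimalPrimes_le hle
      have hq'prime : q'.IsPrime := hq'.1.1
      have hfq' : f j ∈ q' := hq'.1.2 (Ideal.mem_sup_right (Ideal.mem_span_singleton_self _))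
      have hlt : q < q' := lt_of_le_of_ne (le_sup_left.trans hq'.1.2)
        fun h => hfq (h ▸ hfq')
      refine ⟨q', hq'prime, hq'p, ?_, fun i hi a ha => ?_⟩
      · push_cast
        exact (add_le_add_left hht 1).trans (Ideal.height_add_one_le_of_lt_of_isPrime hlt)
      · refine (D' i).map_mem_of_mem_minimalPrimes hchar (fun b hb => ?_) hq' ha
        obtain ⟨c, hc, d, hd, rfl⟩ := Submodule.mem_sup.1 hb
        obtain ⟨e, rfl⟩ := Ideal.mem_span_singleton'.1 hd
        have hij : i ≠ j := fun h => by
          have := congrArg Fin.val h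
          simp only [j] at this
          omega
        rw [map_add, Derivation.leibniz, hD', if_neg hij, smul_zero, zero_add]
        exact Ideal.add_mem _ (Ideal.mem_sup_left (hst i (by omega) _ hc))
          (Ideal.mem_sup_right (by
            rw [smul_eq_mul, mul_comm]
            exact Ideal.mul_mem_left _ _ (Ideal.mem_span_singleton_self _)))
  obtain ⟨q, hq, hqp, hht, -⟩ := key n le_rfl
  exact hht.trans (Ideal.height_mono hqp)

/-- A prime of height less than `n` is preserved by a nontrivial combination of `n` given
derivations. -/
lemma Ideal.exists_derivation_preserving (hchar : ∀ k : ℕ, k ≠ 0 → IsUnit (k : O)) {n : ℕ}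
    (D : Fin n → Derivation ℤ O O) (p : Ideal O) [hp : p.IsPrime] (hht : p.height < n) :
    ∃ ξ : Fin n → O, (∃ i, ξ i ∉ p) ∧ ∀ f ∈ p, ∑ i, ξ i * D i f ∈ p := by
  classical
  let K := FractionRing (O ⧸ p)
  let φ : O →+* K := (algebraMap (O ⧸ p) K).comp (Ideal.Quotient.mk p)
  have hφ : ∀ a, φ a = 0 ↔ a ∈ p := fun a => by
    rw [RingHom.comp_apply, FaithfulSMul.algebraMap_eq_zero_iff, Ideal.Quotient.eq_zero_iff_mem]
  let v : p → Fin n → K := fun f i => φ (D i f)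
  have hspan : Submodule.span K (Set.range v) ≠ ⊤ := by
    intro htop
    obtain ⟨b, hb, hbspan, hbli⟩ := exists_linearIndependent K (Set.range v)
    let B : Module.Basis b K (Fin n → K) := Module.Basis.mk hbli (by
      rw [Subtype.range_coe, hbspan, htop])
    have : Fintype b := FiniteDimensional.fintypeBasisIndex B
    have hcard : Fintype.card b = n := by
      rw [← Module.finrank_eq_card_basis B, Module.finrank_fin_fun]
    let e : b ≃ Fin n := Fintype.equivFinOfCardEq hcard
    choose g hg using fun j : Fin n => hb (e.symm j).2
    refine hht.not_ge (p.le_height_of_det_notMem hchar D (fun j => (g j : O)) (fun j => (g j).2) ?_)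
    intro hdet
    rw [← hφ, RingHom.map_det] at hdet
    have hli : LinearIndependent K (fun j : Fin n => v (g j)) := by
      have : (fun j : Fin n => v (g j)) = (Subtype.val : b → _) ∘ e.symm := funext hg
      rw [this]
      exact hbli.comp _ e.symm.injective
    have hM : IsUnit (Matrix.of fun j => v (g j)) := Matrix.linearIndependent_rows_iff_isUnit.1 hli
    rw [Matrix.isUnit_iff_isUnit_det, ← Matrix.det_transpose] at hM
    refine hM.ne_zero ?_
    rw [← hdet]
    rfl
  obtain ⟨ℓ, hℓ0, hℓ⟩ := Submodule.exists_le_ker_of_lt_top _ (lt_top_iff_ne_top.2 hspan)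
  obtain ⟨c, hc⟩ := IsLocalization.exist_integer_multiples_of_finite (nonZeroDivisors (O ⧸ p))
    (fun i : Fin n => ℓ (Pi.single i 1))
  choose η hη using hc
  choose ξ hξ using fun i => Ideal.Quotient.mk_surjective (I := p) (η i)
  have hφξ : ∀ i, φ (ξ i) = algebraMap (O ⧸ p) K c * ℓ (Pi.single i 1) := fun i => by
    rw [RingHom.comp_apply, hξ, hη, Algebra.smul_def]
  refine ⟨ξ, ?_, fun f hf => ?_⟩
  · by_contra! h
    refine hℓ0 (LinearMap.pi_ext' fun i => LinearMap.ext_ring ?_)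
    have h1 := hφξ i
    rw [(hφ _).2 (h i)] at h1
    have hc0 : algebraMap (O ⧸ p) K c ≠ 0 := by
      rw [Ne, FaithfulSMul.algebraMap_eq_zero_iff]
      exact nonZeroDivisors.ne_zero c.2
    simpa [hc0] using h1.symm
  · rw [← hφ, map_sum]
    have h1 : ℓ (v ⟨f, hf⟩) = 0 := hℓ (Submodule.subset_span ⟨_, rfl⟩)
    have h2 : v ⟨f, hf⟩ = ∑ i, φ (D i f) • (Pi.single i 1 : Fin n → K) := by
      ext j; simp [v, Finset.sum_apply, Pi.single_apply]
    rw [h2, map_sum] at h1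
    simp only [map_smul, smul_eq_mul] at h1
    calc ∑ i, φ (ξ i * D i f) = algebraMap (O ⧸ p) K c * ∑ i, φ (D i f) * ℓ (Pi.single i 1) := by
          rw [Finset.mul_sum]
          refine Finset.sum_congr rfl fun i _ => ?_
          rw [map_mul, hφξ]; ring
      _ = 0 := by rw [h1, mul_zero]

/-- A prime properly contained in a prime with `n` generators is preserved by a nontrivial
combination of `n` given derivations. -/
lemma Ideal.exists_derivation_preserving_of_lt [IsNoetherianRing O]
    (hchar : ∀ k : ℕ, k ≠ 0 → IsUnit (k : O)) {n : ℕ}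
    (D : Fin n → Derivation ℤ O O) (p m : Ideal O) [hp : p.IsPrime] [hm : m.IsPrime] (hpm : p < m)
    (x : Fin n → O) (hx : m = Ideal.span (Set.range x)) :
    ∃ ξ : Fin n → O, (∃ i, ξ i ∉ p) ∧ ∀ f ∈ p, ∑ i, ξ i * D i f ∈ p := by
  classical
  refine p.exists_derivation_preserving hchar D ?_
  have h1 : m.height ≤ n := by
    have hmin : m ∈ (Ideal.span ((Finset.univ.image x : Finset O) : Set O)).minimalPrimes := by
      rw [Finset.coe_image, Finset.coe_univ, Set.image_univ, ← hx, Ideal.minimalPrimes_eq_subsingleton_self]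
      exact rfl
    refine (Ideal.height_le_card_of_mem_minimalPrimes_span_finset hmin).trans ?_
    exact_mod_cast Finset.card_image_le.trans (by simp)
  have h2 := Ideal.height_add_one_le_of_lt_of_isPrime hpm
  have h3 : p.height + 1 ≤ n := h2.trans h1
  have hne : p.height ≠ ⊤ := fun h => by simp [h] at h3
  exact (ENat.add_one_le_iff hne).1 h3

end DifferentialIdeals

/-- `γ` is a family of local integral curves of `v` starting at the points near the origin. -/
def IsLocalFlow {E : Type*} [NormedAddCommGroup E] [NormedSpace ℝ E] (v : E → E) (γ : E → ℝ → E) :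
    Prop :=
  ∀ᶠ x in 𝓝 0, γ x 0 = x ∧ ∀ᶠ t in 𝓝 0, HasDerivAt (γ x) (v (γ x t)) t

namespace IsLocalFlow

variable {E : Type*} [NormedAddCommGroup E] [NormedSpace ℝ E] {v : E → E} {γ : E → ℝ → E}

lemma exists_of_contDiffAt [CompleteSpace E] (hv : ContDiffAt ℝ 1 v 0) : ∃ γ, IsLocalFlow v γ := by
  obtain ⟨γ, h⟩ := hv.exists_eventually_eq_hasDerivAt 0
  refine ⟨γ, ?_⟩
  filter_upwards [h.curry] with x hx
  exact ⟨hx.self_of_nhds.1, hx.mono fun t ht => ht.2⟩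

lemma eventually (h : IsLocalFlow v γ) {p : E → Prop} (hp : ∀ᶠ x in 𝓝 0, p x) :
    ∀ᶠ x in 𝓝 0, ∀ᶠ t in 𝓝 0, p (γ x t) := by
  filter_upwards [h, eventually_eventually_nhds.2 hp] with x hx hpx
  have hc : ContinuousAt (γ x) 0 := hx.2.self_of_nhds.continuousAt
  refine hc.eventually ?_
  rwa [hx.1]

lemma hasDerivAt_comp (h : IsLocalFlow v γ) {f f' : E → ℝ}
    (hf : ∀ᶠ x in 𝓝 0, DifferentiableAt ℝ f x ∧ fderiv ℝ f x (v x) = f' x) :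
    ∀ᶠ x in 𝓝 0, ∀ᶠ t in 𝓝 0, HasDerivAt (fun t => f (γ x t)) (f' (γ x t)) t := by
  filter_upwards [h, h.eventually hf] with x hx hfx
  filter_upwards [hx.2, hfx] with t ht hft
  rw [← hft.2]
  exact hft.1.hasFDerivAt.comp_hasDerivAt t ht

lemma eventually_eq_const (h : IsLocalFlow v γ) {f f' : E → ℝ}
    (hf : ∀ᶠ x in 𝓝 0, DifferentiableAt ℝ f x ∧ fderiv ℝ f x (v x) = f' x) :
    ∀ᶠ x in 𝓝 0, (∀ᶠ t in 𝓝 0, f' (γ x t) = 0) → ∀ᶠ t in 𝓝 0, f (γ x t) = f x := by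
  filter_upwards [h, h.hasDerivAt_comp hf] with x hx hd hf'
  have h1 : ∀ᶠ t in 𝓝 (0 : ℝ), HasDerivAt (fun t => f (γ x t)) 0 t := by
    filter_upwards [hd, hf'] with t h1 h2
    rwa [h2] at h1
  refine ODE_solution_unique_of_eventually (v := fun _ _ => (0 : ℝ)) (s := fun _ => Set.univ)
    (K := 0) (f := fun t => f (γ x t)) (g := fun _ => f x)
    (Eventually.of_forall fun t => (LipschitzWith.const 0).lipschitzOnWith)
    (h1.mono fun t ht => ⟨ht, trivial⟩)
    (Eventually.of_forall fun t => ⟨hasDerivAt_const _ _, trivial⟩) ?_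
  simp only [hx.1]

/-- If the derivatives of the `e b` along the flow are linear combinations of the `e b`, the
common zero set of the `e b` is locally invariant. -/
lemma eventually_eq_zero (h : IsLocalFlow v γ) {ι : Type*} [Fintype ι] {e : ι → E → ℝ}
    {c : ι → ι → E → ℝ} (hc : ∀ a b, ContinuousAt (c a b) 0)
    (he : ∀ a, ∀ᶠ x in 𝓝 0,
      DifferentiableAt ℝ (e a) x ∧ fderiv ℝ (e a) x (v x) = ∑ b, c a b x * e b x) :
    ∀ᶠ x in 𝓝 0, (∀ a, e a x = 0) → ∀ᶠ t in 𝓝 0, ∀ a, e a (γ x t) = 0 := by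
  have hbound : ∀ᶠ x in 𝓝 (0 : E), ∀ a b, ‖c a b x‖ ≤ ‖c a b 0‖ + 1 :=
    eventually_all.2 fun a => eventually_all.2 fun b =>
      ((hc a b).norm.eventually_lt continuousAt_const (lt_add_one _)).mono fun _ => le_of_lt
  obtain ⟨M, hM⟩ : ∃ M : ℝ≥0, M = ∑ a, ∑ b, (‖c a b 0‖₊ + 1) := ⟨_, rfl⟩
  filter_upwards [h, h.eventually hbound,
    eventually_all.2 fun a => h.hasDerivAt_comp (he a)] with x hx hcx hd h0
  have key : (fun t a => e a (γ x t)) =ᶠ[𝓝 0] fun _ => 0 := by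
    refine ODE_solution_unique_of_eventually
      (v := fun t (u : ι → ℝ) a => ∑ b, c a b (γ x t) * u b) (s := fun _ => Set.univ) (K := M)
      ?_ ?_ ?_ ?_
    · filter_upwards [hcx] with t ht
      refine LipschitzWith.lipschitzOnWith (LipschitzWith.of_dist_le_mul fun u w => ?_)
      refine (dist_pi_le_iff (by positivity)).2 fun a => ?_
      rw [Real.dist_eq, ← Finset.sum_sub_distrib]
      calc |∑ b, (c a b (γ x t) * u b - c a b (γ x t) * w b)|
          ≤ ∑ b, |c a b (γ x t) * u b - c a b (γ x t) * w b| := Finset.abs_sum_le_sum_abs _ _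
        _ ≤ ∑ b, (‖c a b 0‖ + 1) * dist u w := by
            refine Finset.sum_le_sum fun b _ => ?_
            rw [← mul_sub, abs_mul]
            exact mul_le_mul (ht a b) (by rw [← Real.dist_eq]; exact dist_le_pi_dist u w b)
              (abs_nonneg _) (by positivity)
        _ = (∑ b, (‖c a b 0‖ + 1)) * dist u w := by rw [Finset.sum_mul]
        _ ≤ M * dist u w := by
            refine mul_le_mul_of_nonneg_right ?_ dist_nonneg
            rw [hM]
            push_cast
            exact Finset.single_le_sum (f := fun a => ∑ b, (‖c a b 0‖ + 1))
              (fun a _ => by positivity) (Finset.mem_univ a)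
    · filter_upwards [eventually_all.2 hd] with t ht
      exact ⟨hasDerivAt_pi.2 ht, trivial⟩
    · refine Eventually.of_forall fun t => ⟨?_, trivial⟩
      convert hasDerivAt_const t (0 : ι → ℝ) using 1
      ext a
      simp
    · ext a
      simp [hx.1, h0]
  filter_upwards [key] with t ht a
  exact congrFun ht a

end IsLocalFlow

namespace analyticGerms

variable {n : ℕ}

/-- The ideal of germs vanishing along a sequence, with respect to an ultrafilter. -/
noncomputable def idealAlong (𝒰 : Ultrafilter ℕ) {z : ℕ → Fin n → ℝ}
    (hz : Tendsto z 𝒰 (𝓝 0)) : Ideal (analyticGerms n) where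
  carrier := {g | ∀ᶠ i in 𝒰, rep g (z i) = 0}
  zero_mem' := hz.eventually rep_zero
  add_mem' {a b} ha hb := by
    filter_upwards [ha, hb, hz.eventually (rep_add a b)] with i h1 h2 h3
    rw [h3, Pi.add_apply, h1, h2, add_zero]
  smul_mem' a b hb := by
    filter_upwards [hb, hz.eventually (rep_mul a b)] with i h1 h2
    rw [smul_eq_mul, h2, Pi.mul_apply, h1, mul_zero]

variable {𝒰 : Ultrafilter ℕ} {z : ℕ → Fin n → ℝ} (hz : Tendsto z 𝒰 (𝓝 0))

lemma mem_idealAlong {g : analyticGerms n} :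
    g ∈ idealAlong 𝒰 hz ↔ ∀ᶠ i in 𝒰, rep g (z i) = 0 := Iff.rfl

instance : (idealAlong 𝒰 hz).IsPrime where
  ne_top' h := by
    have h1 : ∀ᶠ i in 𝒰, rep (1 : analyticGerms n) (z i) = 0 :=
      (Ideal.eq_top_iff_one _).1 h
    obtain ⟨i, h2, h3⟩ := (h1.and (hz.eventually rep_one)).exists
    simp [h2] at h3
  mem_or_mem' {a b} hab := by
    refine Ultrafilter.eventually_or.1 ?_
    filter_upwards [(mem_idealAlong hz).1 hab, hz.eventually (rep_mul a b)] with i h1 h2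
    rw [h2, Pi.mul_apply] at h1
    exact mul_eq_zero.1 h1

lemma idealAlong_lt (hz0 : ∀ᶠ i in 𝒰, z i ≠ 0) : idealAlong 𝒰 hz < maxIdeal n := by
  refine lt_of_le_of_ne (fun g hg => mem_maxIdeal.2 ?_) fun h => ?_
  · refine tendsto_nhds_unique ((analyticAt_rep g).continuousAt.tendsto.comp hz) ?_
    exact tendsto_const_nhds.congr' (((mem_idealAlong hz).1 hg).mono fun i hi => hi.symm)
  · have h1 : ∀ᶠ i in 𝒰, ∀ j, rep (coord j) (z i) = 0 := eventually_all.2 fun j =>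
      (mem_idealAlong hz).1 (by
        rw [h, maxIdeal_eq_span]
        exact Ideal.subset_span ⟨j, rfl⟩)
    have h2 : ∀ᶠ x in 𝓝 (0 : Fin n → ℝ), ∀ j, rep (coord j) x = x j :=
      eventually_all.2 fun j => rep_mk _ _
    obtain ⟨i, h3, h4, h5⟩ := (h1.and ((hz.eventually h2).and hz0)).exists
    exact h5 (funext fun j => by rw [← h4, h3]; rfl)

/-- The directional derivative of a germ along a vector field. -/
noncomputable def along (ξ : Fin n → analyticGerms n) (g : analyticGerms n) : analyticGerms n :=
  ∑ i, ξ i * pd i g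

lemma along_spec (ξ : Fin n → analyticGerms n) (g : analyticGerms n) :
    ∀ᶠ x in 𝓝 0, DifferentiableAt ℝ (rep g) x ∧
      fderiv ℝ (rep g) x (fun i => rep (ξ i) x) = rep (along ξ g) x := by
  have h1 : ∀ᶠ x in 𝓝 (0 : Fin n → ℝ), ∀ i, rep (ξ i * pd i g) x = rep (ξ i) x * rep (pd i g) x :=
    eventually_all.2 fun i => rep_mul _ _
  have h2 : ∀ᶠ x in 𝓝 (0 : Fin n → ℝ), ∀ i, rep (pd i g) x = fderiv ℝ (rep g) x (Pi.single i 1) :=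
    eventually_all.2 fun i => rep_pd i g
  filter_upwards [eventually_differentiableAt_rep g, h1, h2,
    rep_sum Finset.univ fun i => ξ i * pd i g] with x h3 h4 h5 h6
  refine ⟨h3, ?_⟩
  have h7 : (fun i => rep (ξ i) x) = ∑ i, rep (ξ i) x • (Pi.single i 1 : Fin n → ℝ) := by
    ext j
    simp [Finset.sum_apply, Pi.single_apply]
  rw [along, h6, h7, map_sum]
  refine Finset.sum_congr rfl fun i _ => ?_
  rw [map_smul, smul_eq_mul, h4, h5]

lemma along_coord (ξ : Fin n → analyticGerms n) (i : Fin n) : along ξ (coord i) = ξ i := by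
  refine ext_rep ?_
  filter_upwards [along_spec ξ (coord i), (rep_mk (fun x : Fin n → ℝ => x i)
    ((ContinuousLinearMap.proj (R := ℝ) (φ := fun _ : Fin n => ℝ) i).analyticAt 0)).fderiv (𝕜 := ℝ)]
    with x h1 h2
  rw [← h1.2, coord, h2, (hasFDerivAt_apply i x).fderiv]
  rfl

lemma exists_isLocalFlow (ξ : Fin n → analyticGerms n) :
    ∃ γ, IsLocalFlow (fun x i => rep (ξ i) x) γ :=
  IsLocalFlow.exists_of_contDiffAt (contDiffAt_pi.2 fun i => (analyticAt_rep (ξ i)).contDiffAt)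

lemma eventually_rep_flow_eq_zero {ξ : Fin n → analyticGerms n} {γ}
    (hγ : IsLocalFlow (fun x i => rep (ξ i) x) γ)
    (hξ : ∀ g ∈ idealAlong 𝒰 hz, along ξ g ∈ idealAlong 𝒰 hz) {g} (hg : g ∈ idealAlong 𝒰 hz) :
    ∀ᶠ i in 𝒰, ∀ᶠ t in 𝓝 0, rep g (γ (z i) t) = 0 := by
  classical
  obtain ⟨s, hs⟩ := (IsNoetherian.noetherian (idealAlong 𝒰 hz) : (idealAlong 𝒰 hz).FG)
  have hcomb : ∀ h ∈ idealAlong 𝒰 hz, ∃ c : s → analyticGerms n, ∑ b, c b * b.1 = h := by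
    intro h hh
    rw [← hs] at hh
    obtain ⟨c, hc⟩ := Submodule.mem_span_finset'.1 hh
    exact ⟨c, hc⟩
  have hes : ∀ b : s, b.1 ∈ idealAlong 𝒰 hz := fun b => by
    rw [← hs]; exact Ideal.subset_span b.2
  have hrep : ∀ (h : analyticGerms n) (c : s → analyticGerms n), ∑ b, c b * b.1 = h →
      ∀ᶠ x in 𝓝 0, rep h x = ∑ b, rep (c b) x * rep b.1 x := by
    rintro _ c rfl
    have h1 : ∀ᶠ x in 𝓝 (0 : Fin n → ℝ), ∀ b : s, rep (c b * b.1) x = rep (c b) x * rep b.1 x :=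
      eventually_all.2 fun b => rep_mul _ _
    filter_upwards [h1, rep_sum Finset.univ fun b : s => c b * b.1] with x h2 h3
    rw [h3]
    exact Finset.sum_congr rfl fun b _ => h2 b
  choose c hc using fun a : s => hcomb _ (hξ _ (hes a))
  have h1 := hγ.eventually_eq_zero (e := fun a : s => rep a.1) (c := fun a b => rep (c a b))
    (fun a b => (analyticAt_rep _).continuousAt) fun a => by
      filter_upwards [along_spec ξ a.1, hrep _ _ (hc a)] with x h2 h3
      exact ⟨h2.1, h2.2.trans h3⟩
  obtain ⟨d, hd⟩ := hcomb g hg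
  filter_upwards [hz.eventually h1, hz.eventually (hγ.eventually (hrep g d hd)),
    eventually_all.2 fun b : s => (mem_idealAlong hz).1 (hes b)] with i h2 h3 h4
  filter_upwards [h2 h4, h3] with t h5 h6
  rw [h6]
  exact Finset.sum_eq_zero fun b _ => by rw [h5, mul_zero]

/-- Points of a closed basic semianalytic set that are local lexicographic minima for a family
of germs containing the coordinates cannot accumulate at the origin. -/
theorem false_of_lex_min (hz : Tendsto z 𝒰 (𝓝 0)) (hz0 : ∀ᶠ i in 𝒰, z i ≠ 0) {X : Set (Fin n → ℝ)}
    {ι κ : Type*} [Finite ι] [Finite κ] (f : ι → analyticGerms n) (g : κ → analyticGerms n)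
    (hX : ∀ᶠ x in 𝓝 0, x ∈ X ↔ (∀ a, rep (f a) x = 0) ∧ ∀ b, 0 ≤ rep (g b) x)
    (hzX : ∀ᶠ i in 𝒰, z i ∈ X) {N : ℕ} (φ : Fin N → analyticGerms n)
    (hφ : ∀ i, ∃ j, φ j = coord i)
    (hmin : ∀ᶠ i in 𝒰, ∀ j, ∀ᶠ y in 𝓝 (z i), y ∈ X →
      (∀ l < j, rep (φ l) y = rep (φ l) (z i)) → rep (φ j) (z i) ≤ rep (φ j) y) : False := by
  obtain ⟨ξ, ⟨i₀, hi₀⟩, hξ⟩ := Ideal.exists_derivation_preserving_of_lt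
    (fun k hk => isUnit_natCast hk) (pd (n := n)) _ _ (idealAlong_lt hz hz0) coord maxIdeal_eq_span
  obtain ⟨γ, hγ⟩ := exists_isLocalFlow ξ
  have hflow : ∀ h ∈ idealAlong 𝒰 hz, ∀ᶠ i in 𝒰, ∀ᶠ t in 𝓝 0, rep h (γ (z i) t) = 0 :=
    fun h hh => eventually_rep_flow_eq_zero hz hγ hξ hh
  have hcont : ∀ᶠ i in 𝒰, γ (z i) 0 = z i ∧ ContinuousAt (γ (z i)) 0 := by
    filter_upwards [hz.eventually hγ] with i hi
    exact ⟨hi.1, hi.2.self_of_nhds.continuousAt⟩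
  have hstay : ∀ᶠ i in 𝒰, ∀ᶠ t in 𝓝 0, γ (z i) t ∈ X := by
    have hf : ∀ᶠ i in 𝒰, ∀ a, ∀ᶠ t in 𝓝 0, rep (f a) (γ (z i) t) = 0 := by
      refine eventually_all.2 fun a => hflow _ ?_
      filter_upwards [hzX, hz.eventually hX] with i h1 h2
      exact (h2.1 h1).1 a
    have hg : ∀ᶠ i in 𝒰, ∀ b, ∀ᶠ t in 𝓝 0, 0 ≤ rep (g b) (γ (z i) t) := by
      refine eventually_all.2 fun b => ?_
      by_cases hb : g b ∈ idealAlong 𝒰 hz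
      · filter_upwards [hflow _ hb] with i hi
        exact hi.mono fun t ht => ht.ge
      · rw [mem_idealAlong, ← Ultrafilter.eventually_not] at hb
        filter_upwards [hb, hzX, hz.eventually hX, hcont,
          hz.eventually (analyticAt_rep (g b)).eventually_analyticAt] with i h1 h2 h3 h4 h5
        have hpos : 0 < rep (g b) (γ (z i) 0) := by
          rw [h4.1]
          exact lt_of_le_of_ne ((h3.1 h2).2 b) (Ne.symm h1)
        rw [← h4.1] at h5
        exact ((h5.continuousAt.comp (f := γ (z i)) h4.2).eventually
          (lt_mem_nhds hpos)).mono fun t ht => le_of_lt ht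
    filter_upwards [hf, hg, hz.eventually (hγ.eventually hX)] with i h1 h2 h3
    filter_upwards [eventually_all.2 h1, eventually_all.2 h2, h3] with t h4 h5 h6
    exact h6.2 ⟨h4, h5⟩
  have key : ∀ j : Fin N, along ξ (φ j) ∈ idealAlong 𝒰 hz := by
    intro j
    induction j using WellFoundedLT.induction with
    | ind j ih =>
    have hconst : ∀ᶠ i in 𝒰, ∀ l, l < j → ∀ᶠ t in 𝓝 0, rep (φ l) (γ (z i) t) = rep (φ l) (z i) := by
      refine eventually_all.2 fun l => ?_
      by_cases hl : l < j
      · filter_upwards [hflow _ (ih l hl),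
          hz.eventually (hγ.eventually_eq_const (along_spec ξ (φ l)))] with i h1 h2 _
        exact h2 h1
      · exact Eventually.of_forall fun i h => absurd h hl
    filter_upwards [hconst, hmin, hstay, hcont,
      hz.eventually (hγ.hasDerivAt_comp (along_spec ξ (φ j)))] with i h1 h2 h3 h4 h5
    have h6 := h5.self_of_nhds
    have h7 : IsLocalMin (fun t => rep (φ j) (γ (z i) t)) 0 := by
      have h8 : ∀ᶠ t in 𝓝 (0 : ℝ), _ := h4.2.eventually (by rw [h4.1]; exact h2 j)
      filter_upwards [h8, h3, eventually_all.2 fun l => eventually_all.2 (h1 l)] with t h9 h10 h11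
      simp only [h4.1]
      exact h9 h10 h11
    have h8 := h7.hasDerivAt_eq_zero h6
    rwa [h4.1] at h8
  obtain ⟨j, hj⟩ := hφ i₀
  refine hi₀ ?_
  rw [← along_coord ξ i₀, ← hj]
  exact key j

end analyticGerms

section LocallyClosedBasic

/-- A compact nonempty set contains a lexicographic minimum of finitely many continuous
functions. -/
lemma IsCompact.exists_lex_min {E : Type*} [TopologicalSpace E] {N : ℕ} {K : Set E}
    (hK : IsCompact K) (hne : K.Nonempty) {ψ : Fin N → E → ℝ} (hψ : ∀ j, Continuous (ψ j)) :
    ∃ z ∈ K, ∀ j, ∀ y ∈ K, (∀ l < j, ψ l y = ψ l z) → ψ j z ≤ ψ j y := by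
  induction N generalizing K with
  | zero => exact ⟨hne.some, hne.some_mem, fun j => j.elim0⟩
  | succ N ih =>
    obtain ⟨a, ha, hmin⟩ := hK.exists_isMinOn hne (hψ 0).continuousOn
    obtain ⟨z, hz, hzmin⟩ := ih (hK.inter_right (isClosed_eq (hψ 0) continuous_const))
      ⟨a, ha, (rfl : ψ 0 a = ψ 0 a)⟩ (ψ := fun j => ψ j.succ) fun j => hψ j.succ
    have hz0 : ψ 0 z = ψ 0 a := hz.2
    refine ⟨z, hz.1, fun j y hy h => ?_⟩
    cases j using Fin.cases with
    | zero => rw [hz0]; exact hmin hy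
    | succ j =>
      exact hzmin j y ⟨hy, (h 0 (Fin.succ_pos j)).trans hz0⟩
        fun l hl => h l.succ (Fin.succ_lt_succ_iff.2 hl)

/-- In a compact Hausdorff set, points outside a connected component are separated from it by a
relatively clopen set. -/
lemma IsCompact.exists_compact_of_notMem_connectedComponentIn {E : Type*} [TopologicalSpace E]
    [T2Space E] {X : Set E} (hX : IsCompact X) {p q : E} (hp : p ∈ X) (hq : q ∈ X)
    (hpq : q ∉ connectedComponentIn X p) :
    ∃ C ⊆ X, IsCompact C ∧ q ∈ C ∧ p ∉ C ∧ ∀ z ∈ C, ∀ᶠ y in 𝓝 z, y ∈ X → y ∈ C := by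
  have : CompactSpace X := isCompact_iff_compactSpace.1 hX
  rw [connectedComponentIn_eq_image hp, connectedComponent_eq_iInter_isClopen] at hpq
  obtain ⟨s, hs, hps, hqs⟩ : ∃ s : Set X, IsClopen s ∧ ⟨p, hp⟩ ∈ s ∧ ⟨q, hq⟩ ∉ s := by
    by_contra! h
    exact hpq ⟨⟨q, hq⟩, Set.mem_iInter.2 fun s => h s.1 s.2.1 s.2.2, rfl⟩
  obtain ⟨O, hO, hOs⟩ := isOpen_induced_iff.1 hs.compl.isOpen
  have hmem : ∀ y, y ∈ Subtype.val '' sᶜ ↔ y ∈ X ∧ y ∈ O := by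
    intro y
    rw [← hOs]
    simp
  refine ⟨Subtype.val '' sᶜ, by simp, hs.compl.isClosed.isCompact.image continuous_subtype_val,
    ⟨_, hqs, rfl⟩, ?_, fun z hz => ?_⟩
  · rintro ⟨y, hy, hyp⟩
    exact hy (by rwa [show y = ⟨p, hp⟩ from Subtype.ext hyp])
  · filter_upwards [hO.mem_nhds ((hmem z).1 hz).2] with y hy hyX
    exact (hmem y).2 ⟨hyX, hy⟩

variable {E : Type*} [NormedAddCommGroup E] [NormedSpace ℝ E]

/-- Near `p`, the set `X` is defined by finitely many equations `f a = 0` and inequalities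
`0 ≤ g b` between analytic functions. -/
def IsClosedBasicAt (X : Set E) (p : E) : Prop :=
  ∃ (ι κ : Type) (_ : Finite ι) (_ : Finite κ) (f : ι → E → ℝ) (g : κ → E → ℝ),
    (∀ a, AnalyticAt ℝ (f a) p) ∧ (∀ b, AnalyticAt ℝ (g b) p) ∧
      ∀ᶠ x in 𝓝 p, x ∈ X ↔ (∀ a, f a x = 0) ∧ ∀ b, 0 ≤ g b x

open analyticGerms in
/-- Points of `X` near `p` lie in the connected component of `p`. -/
theorem IsClosedBasicAt.eventually_mem_connectedComponentIn [FiniteDimensional ℝ E] {X : Set E}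
    (hX : IsCompact X) {p : E} (hp : p ∈ X) (h : IsClosedBasicAt X p) :
    ∀ᶠ x in 𝓝 p, x ∈ X → x ∈ connectedComponentIn X p := by
  obtain ⟨ι, κ, _, _, f, g, hf, hg, hfg⟩ := h
  by_contra hcon
  rw [Filter.not_eventually] at hcon
  obtain ⟨x, hxp, hx⟩ := exists_seq_forall_of_frequently hcon
  simp only [Classical.not_imp] at hx
  choose C hCX hC hxC hpC hCopen using
    fun i => hX.exists_compact_of_notMem_connectedComponentIn hp (hx i).1 (hx i).2
  let n := Module.finrank ℝ E
  let e : E ≃L[ℝ] (Fin n → ℝ) := (Module.finBasis ℝ E).equivFunL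
  let Φ : Fin (n + 1) → (Fin n → ℝ) → ℝ := Fin.cons (fun x => ∑ i, x i ^ 2) fun i x => x i
  have hΦa : ∀ j, AnalyticAt ℝ (Φ j) 0 := by
    intro j
    cases j using Fin.cases with
    | zero =>
      simp only [Φ, Fin.cons_zero]
      exact Finset.univ.analyticAt_fun_sum fun i _ =>
        ((ContinuousLinearMap.proj (R := ℝ) (φ := fun _ : Fin n => ℝ) i).analyticAt 0).fun_pow 2
    | succ i => exact (ContinuousLinearMap.proj (R := ℝ) (φ := fun _ : Fin n => ℝ) i).analyticAt 0
  have hΦc : ∀ j, Continuous (Φ j) := by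
    intro j
    cases j using Fin.cases with
    | zero => simp only [Φ, Fin.cons_zero]; fun_prop
    | succ i => simp only [Φ, Fin.cons_succ]; fun_prop
  have hchart : Continuous fun y => e (y - p) := by fun_prop
  have hinv : Continuous fun y => e.symm y + p := by fun_prop
  have hinv0 : Tendsto (fun y => e.symm y + p) (𝓝 0) (𝓝 p) := by
    simpa using hinv.tendsto 0
  choose z hzC hzmin using fun i =>
    (hC i).exists_lex_min ⟨_, hxC i⟩ (ψ := fun j y => Φ j (e (y - p))) fun j => (hΦc j).comp hchart
  have hle : ∀ i, Φ 0 (e (z i - p)) ≤ Φ 0 (e (x i - p)) := fun i =>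
    hzmin i 0 _ (hxC i) fun l hl => absurd hl (Fin.not_lt_zero l)
  have hρ : Tendsto (fun i => Φ 0 (e (z i - p))) atTop (𝓝 0) := by
    refine squeeze_zero (fun i => ?_) hle ?_
    · simp only [Φ, Fin.cons_zero]
      positivity
    have h1 : Tendsto (fun i => Φ 0 (e (x i - p))) atTop (𝓝 (Φ 0 (e (p - p)))) :=
      (((hΦc 0).comp hchart).tendsto p).comp hxp
    have h2 : Φ 0 (e (p - p)) = 0 := by simp [Φ]
    rwa [h2] at h1
  have hz : Tendsto (fun i => e (z i - p)) atTop (𝓝 0) := by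
    refine tendsto_pi_nhds.2 fun j => ?_
    have h1 : Tendsto (fun i => √(Φ 0 (e (z i - p)))) atTop (𝓝 0) := by
      simpa using hρ.sqrt
    refine squeeze_zero_norm (fun i => ?_) h1
    rw [Real.norm_eq_abs]
    refine Real.abs_le_sqrt ?_
    exact Finset.single_le_sum (f := fun j => e (z i - p) j ^ 2) (fun _ _ => sq_nonneg _)
      (Finset.mem_univ j)
  have hback : ∀ y : E, e.symm (e (y - p)) + p = y := fun y => by simp
  have hana : ∀ {u : E → ℝ}, AnalyticAt ℝ u p → AnalyticAt ℝ (fun y => u (e.symm y + p)) 0 := by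
    intro u hu
    refine AnalyticAt.fun_comp (g := u) (f := fun y => e.symm y + p) (by simpa using hu) ?_
    exact ((e.symm : (Fin n → ℝ) →L[ℝ] E).analyticAt 0).add analyticAt_const
  have hN : ((hyperfilter ℕ : Ultrafilter ℕ) : Filter ℕ) ≤ atTop := Nat.hyperfilter_le_atTop
  refine false_of_lex_min (𝒰 := hyperfilter ℕ) (hz.mono_left hN)
    (Eventually.of_forall fun i h0 => ?_) (X := {y | e.symm y + p ∈ X})
    (fun a => mk _ (hana (hf a))) (fun b => mk _ (hana (hg b))) ?_
    (Eventually.of_forall fun i => ?_) (fun j => mk _ (hΦa j)) (fun i => ⟨i.succ, rfl⟩) ?_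
  · have h1 : z i = p := by
      rw [← hback (z i), h0]
      simp
    exact hpC i (h1 ▸ hzC i)
  · filter_upwards [hinv0.eventually hfg, eventually_all.2 fun a => rep_mk _ (hana (hf a)),
      eventually_all.2 fun b => rep_mk _ (hana (hg b))] with y h1 h2 h3
    simp only [h1, h2, h3]
  · simpa only [Set.mem_ofPred_eq, hback] using hCX i (hzC i)
  · have hrep : ∀ᶠ y in 𝓝 (0 : Fin n → ℝ), ∀ j, rep (mk _ (hΦa j)) y = Φ j y :=
      eventually_all.2 fun j => rep_mk _ (hΦa j)
    filter_upwards [(hz.mono_left hN).eventually (eventually_eventually_nhds.2 hrep)] with i hi j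
    have h1 : Tendsto (fun y => e.symm y + p) (𝓝 (e (z i - p))) (𝓝 (z i)) := by
      have := hinv.tendsto (e (z i - p))
      rwa [hback] at this
    filter_upwards [hi, h1.eventually (hCopen i _ (hzC i))] with y h2 h3 hyX h4
    simp only [h2, hi.self_of_nhds] at h4 ⊢
    have h5 := hzmin i j _ (h3 hyX)
    simp only [add_sub_cancel_right, ContinuousLinearEquiv.apply_symm_apply] at h5
    exact h5 h4

/-- A compact set which is locally defined by analytic equations and weak inequalities has
finitely many connected components. -/
theorem IsCompact.finite_connectedComponentIn_of_isClosedBasicAt [FiniteDimensional ℝ E]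
    {X : Set E} (hX : IsCompact X) (h : ∀ p ∈ X, IsClosedBasicAt X p) :
    {C : Set E | ∃ p ∈ X, C = connectedComponentIn X p}.Finite := by
  obtain ⟨t, -, hXt⟩ := hX.elim_nhds_subcover
    (fun p => {x | x ∈ X → x ∈ connectedComponentIn X p}) fun p hp =>
      (h p hp).eventually_mem_connectedComponentIn hX hp
  refine (t.finite_toSet.image (connectedComponentIn X)).subset ?_
  rintro _ ⟨q, hq, rfl⟩
  obtain ⟨p, hpt, hpq⟩ := Set.mem_iUnion₂.1 (hXt hq)
  exact ⟨p, hpt, connectedComponentIn_eq (hpq hq)⟩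

end LocallyClosedBasic

section Iterates

variable {E : Type*} [NormedAddCommGroup E] [NormedSpace ℝ E]

lemma AnalyticAt.iterate_of_forall_mem {F : E → E} {U : Set E} (hF : ∀ x ∈ U, AnalyticAt ℝ F x)
    {p : E} {m : ℕ} (h : ∀ l < m, F^[l] p ∈ U) : AnalyticAt ℝ F^[m] p := by
  induction m with
  | zero => exact analyticAt_id
  | succ m ih =>
    rw [Function.iterate_succ']
    exact (hF _ (h m (Nat.lt_succ_self m))).comp (ih fun l hl => h l (by omega))

lemma isClosed_setOf_forall_iterate_mem {F : E → E} {U B : Set E}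
    (hF : ∀ x ∈ U, AnalyticAt ℝ F x) (hB : IsClosed B) (hBU : B ⊆ U) (m : ℕ) :
    IsClosed {p | ∀ l < m, F^[l] p ∈ B} := by
  induction m with
  | zero => simp
  | succ m ih =>
    have h1 : ContinuousOn F^[m] {p | ∀ l < m, F^[l] p ∈ B} := fun p hp =>
      (AnalyticAt.iterate_of_forall_mem hF fun l hl => hBU (hp l hl)).continuousAt.continuousWithinAt
    convert h1.preimage_isClosed_of_isClosed ih hB using 1
    ext p
    simp only [Set.mem_ofPred_eq, Set.mem_inter_iff, Set.mem_preimage, Nat.lt_succ_iff_lt_or_eq]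
    grind

/-- The part of a closed set `B` consisting of `k`-periodic points whose orbit stays in `B`
is closed. -/
lemma isClosed_setOf_iterate_eq {F : E → E} {U B : Set E}
    (hF : ∀ x ∈ U, AnalyticAt ℝ F x) (hB : IsClosed B) (hBU : B ⊆ U) (k : ℕ) :
    IsClosed {p | (∀ l < k, F^[l] p ∈ B) ∧ F^[k] p = p} := by
  have h1 : ContinuousOn (fun p => F^[k] p - p) {p | ∀ l < k, F^[l] p ∈ B} := fun p hp =>
    ((AnalyticAt.iterate_of_forall_mem hF fun l hl => hBU (hp l hl)).continuousAt.sub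
      continuousAt_id).continuousWithinAt
  convert h1.preimage_isClosed_of_isClosed (isClosed_setOf_forall_iterate_mem hF hB hBU k)
    (isClosed_singleton (x := 0)) using 1
  ext p
  simp [sub_eq_zero]

end Iterates

/-- A set defined near each of its points by finitely many analytic equations and weak
inequalities is semianalytic near that point. -/
lemma exists_semianalytic_description {E : Type*} [NormedAddCommGroup E] [NormedSpace ℝ E]
    {X V : Set E} {ι κ : Type*} [Finite ι] [Finite κ] {f : ι → E → ℝ} {g : κ → E → ℝ}
    (hf : ∀ a, ∀ x ∈ V, AnalyticAt ℝ (f a) x) (hg : ∀ b, ∀ x ∈ V, AnalyticAt ℝ (g b) x)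
    (hX : ∀ x ∈ V, x ∈ X ↔ (∀ a, f a x = 0) ∧ ∀ b, 0 ≤ g b x) :
    ∃ (N : ℕ) (I : Fin N → ℕ) (h : (i : Fin N) → Fin (I i) → E → ℝ)
      (s : (i : Fin N) → Fin (I i) → Bool),
      (∀ i j, ∀ x ∈ V, AnalyticAt ℝ (h i j) x) ∧
      X ∩ V = (⋃ i, ⋂ j, {x | if s i j then h i j x = 0 else 0 < h i j x}) ∩ V := by
  classical
  let eQ := Finite.equivFin (κ → Bool)
  let eI := Finite.equivFin (ι ⊕ κ)
  refine ⟨_, fun _ => Nat.card (ι ⊕ κ), fun _ j => Sum.elim f g (eI.symm j),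
    fun i j => Sum.elim (fun _ => true) (eQ.symm i) (eI.symm j), fun i j x hx => ?_, ?_⟩
  · change AnalyticAt ℝ (Sum.elim f g (eI.symm j)) x
    rcases eI.symm j with a | b
    exacts [hf a x hx, hg b x hx]
  · ext x
    refine and_congr_left fun hx => ?_
    rw [hX x hx]
    have h1 : ∀ σ : κ → Bool,
        (x ∈ ⋂ j, {x | if Sum.elim (fun _ => true) σ (eI.symm j) = true
          then Sum.elim f g (eI.symm j) x = 0 else 0 < Sum.elim f g (eI.symm j) x}) ↔
        (∀ a, f a x = 0) ∧ ∀ b, if σ b = true then g b x = 0 else 0 < g b x := by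
      intro σ
      rw [Set.mem_iInter, ← eI.forall_congr_right, Sum.forall]
      simp
    rw [Set.mem_iUnion, ← eQ.exists_congr_right]
    simp only [Equiv.symm_apply_apply, h1, exists_and_left]
    refine and_congr_right fun _ => ⟨fun h => ⟨fun b => decide (g b x = 0), fun b => ?_⟩, ?_⟩
    · by_cases hb : g b x = 0
      · simp [hb]
      · simpa [hb] using lt_of_le_of_ne (h b) (Ne.symm hb)
    · rintro ⟨σ, hσ⟩ b
      have h2 := hσ b
      split_ifs at h2
      exacts [h2.ge, h2.le]

/-- For an injective holomorphic `F` on a neighborhood `U` of `0 ∈ ℂ²` with `F 0 = 0` and a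
closed ball `B̄_r(0) ⊆ U`, the set
`P_k = {p ∈ B̄_r(0) : F(p), ..., F^{k−1}(p) ∈ B̄_r(0), Fᵏ(p) = p}` is a compact semianalytic
subset of `U`; in particular it has finitely many connected components. -/
theorem periodic_points_semianalytic (F : ℂ × ℂ → ℂ × ℂ) (U : Set (ℂ × ℂ))
    (hUopen : IsOpen U) (hU : (0 : ℂ × ℂ) ∈ U)
    (hFanal : ∀ x ∈ U, AnalyticAt ℂ F x) (hFinj : Set.InjOn F U) (hF0 : F 0 = 0)
    (r : ℝ) (hr : 0 < r) (hball : Metric.closedBall (0 : ℂ × ℂ) r ⊆ U)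
    (k : ℕ) (hk : 1 ≤ k) (P : Set (ℂ × ℂ))
    (hP : P = {p ∈ Metric.closedBall (0 : ℂ × ℂ) r |
      (∀ l < k, F^[l] p ∈ Metric.closedBall (0 : ℂ × ℂ) r) ∧ F^[k] p = p}) :
    IsCompact P ∧ Semianalytic U P ∧
    {C : Set (ℂ × ℂ) | ∃ p ∈ P, C = connectedComponentIn P p}.Finite := by
  have hFr : ∀ x ∈ U, AnalyticAt ℝ F x := fun x hx => (hFanal x hx).restrictScalars
  let c : Bool → ℂ × ℂ →L[ℝ] ℂ := fun i =>
    if i then ContinuousLinearMap.snd ℝ ℂ ℂ else ContinuousLinearMap.fst ℝ ℂ ℂ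
  let f : Bool × Bool → ℂ × ℂ → ℝ := fun a x =>
    (if a.2 then Complex.imCLM else Complex.reCLM) (c a.1 (F^[k] x - x))
  let g : Fin k × Bool → ℂ × ℂ → ℝ := fun b x =>
    r ^ 2 - (Complex.reCLM (c b.2 (F^[b.1] x)) ^ 2 + Complex.imCLM (c b.2 (F^[b.1] x)) ^ 2)
  have hPiff : ∀ x, x ∈ P ↔ (∀ l < k, F^[l] x ∈ Metric.closedBall (0 : ℂ × ℂ) r) ∧ F^[k] x = x := by
    intro x
    rw [hP]
    exact ⟨fun h => h.2, fun h => ⟨h.1 0 hk, h⟩⟩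
  have hPfg : ∀ x, x ∈ P ↔ (∀ a, f a x = 0) ∧ ∀ b, 0 ≤ g b x := by
    intro x
    rw [hPiff, and_comm]
    refine and_congr ?_ ?_
    · rw [← sub_eq_zero, Prod.ext_iff, Complex.ext_iff, Complex.ext_iff]
      simp [f, c]
    · have h1 : ∀ w : ℂ, ‖w‖ ≤ r ↔ w.re ^ 2 + w.im ^ 2 ≤ r ^ 2 := fun w => by
        rw [← sq_le_sq₀ (norm_nonneg w) hr.le, Complex.sq_norm, Complex.normSq_apply, sq w.re, sq w.im]
      simp [g, c, Prod.norm_def, h1, Fin.forall_iff]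
  have hPorb : ∀ x ∈ P, ∀ l ≤ k, AnalyticAt ℝ F^[l] x := fun x hx l hl =>
    AnalyticAt.iterate_of_forall_mem hFr fun j hj => hball (((hPiff x).1 hx).1 j (by omega))
  have hf : ∀ x, (∀ l ≤ k, AnalyticAt ℝ F^[l] x) → ∀ a, AnalyticAt ℝ (f a) x := by
    intro x hx a
    exact (ContinuousLinearMap.analyticAt _ _).fun_comp
      ((ContinuousLinearMap.analyticAt _ _).fun_comp ((hx k le_rfl).sub analyticAt_id))
  have hg : ∀ x, (∀ l ≤ k, AnalyticAt ℝ F^[l] x) → ∀ b, AnalyticAt ℝ (g b) x := by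
    intro x hx b
    have h1 : AnalyticAt ℝ (fun x => c b.2 (F^[b.1] x)) x :=
      (ContinuousLinearMap.analyticAt _ _).fun_comp (hx b.1 b.1.2.le)
    exact analyticAt_const.sub
      ((((ContinuousLinearMap.analyticAt _ _).fun_comp h1).fun_pow 2).fun_add
        (((ContinuousLinearMap.analyticAt _ _).fun_comp h1).fun_pow 2))
  have hclosed : IsClosed P := by
    rw [show P = _ from Set.ext hPiff]
    exact isClosed_setOf_iterate_eq hFr Metric.isClosed_closedBall hball k
  have hcompact : IsCompact P := (isCompact_closedBall (0 : ℂ × ℂ) r).of_isClosed_subset hclosed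
    fun x hx => ((hPiff x).1 hx).1 0 hk
  refine ⟨hcompact, fun p _ => ?_, hcompact.finite_connectedComponentIn_of_isClosedBasicAt
    fun p hp => ⟨_, _, inferInstance, inferInstance, f, g, hf p (hPorb p hp), hg p (hPorb p hp),
      Eventually.of_forall hPfg⟩⟩
  by_cases hp : p ∈ P
  · refine ⟨{x | ∀ l ≤ k, AnalyticAt ℝ F^[l] x}, ?_, exists_semianalytic_description
      (fun a x hx => hf x hx a) (fun b x hx => hg x hx b) fun x _ => hPfg x⟩
    have h1 : ∀ᶠ x in 𝓝 p, ∀ l : Fin (k + 1), AnalyticAt ℝ F^[l] x := eventually_all.2 fun l =>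
      (hPorb p hp l (by omega)).eventually_analyticAt
    exact h1.mono fun x hx l hl => hx ⟨l, by omega⟩
  · refine ⟨Pᶜ, hclosed.isOpen_compl.mem_nhds hp, 0, fun i => i.elim0, fun i => i.elim0,
      fun i => i.elim0, fun i => i.elim0, ?_⟩
    simp
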